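/- There exists k₀ such that for every integer k ≥ k₀ the function Θ_C^{(k)} is not identically zero on 𝔹ⁿ. -/

import Mathlib

open scoped BigOperators
open Complex MeasureTheory Filter Topology Matrix

namespace BallPaper

noncomputable section

variable {n : ℕ}

/-- The unit ball in ℂⁿ. -/
def ball (n : ℕ) : Set (Fin n → ℂ) := {z | ∑ i, ‖z i‖ ^ 2 < 1}

/-- ⟨z,w⟩ = z₁ conj w₁ + ... + zₙ conj wₙ − 1. -/
def pair (z w : Fin n → ℂ) : ℂ := ∑ i, z i * star (w i) - 1

/-- The Hermitian form of signature (n,1) on ℂ^{n+1}: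
⟨⟨u,v⟩⟩ = u₁ conj v₁ + ... + uₙ conj vₙ − u_{n+1} conj v_{n+1}. -/
def herm (u v : Fin (n + 1) → ℂ) : ℂ :=
  ∑ i : Fin n, u i.castSucc * star (v i.castSucc) - u (Fin.last n) * star (v (Fin.last n))

/-- SU(n,1): determinant-one matrices preserving the (n,1) Hermitian form. -/
def SU (n : ℕ) : Set (Matrix (Fin (n + 1)) (Fin (n + 1)) ℂ) :=
  {A | A.det = 1 ∧ ∀ u v, herm (A.mulVec u) (A.mulVec v) = herm u v}

/-- The denominator a_{n+1,1} z₁ + ... + a_{n+1,n} zₙ + a_{n+1,n+1} of the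
fractional-linear action. -/
def denom (A : Matrix (Fin (n + 1)) (Fin (n + 1)) ℂ) (z : Fin n → ℂ) : ℂ :=
  ∑ j : Fin n, A (Fin.last n) j.castSucc * z j + A (Fin.last n) (Fin.last n)

/-- The fractional-linear action of a matrix on ℂⁿ (defined on the ball). -/
def act (A : Matrix (Fin (n + 1)) (Fin (n + 1)) ℂ) (z : Fin n → ℂ) : Fin n → ℂ :=
  fun j => (∑ l : Fin n, A j.castSucc l.castSucc * z l + A j.castSucc (Fin.last n)) / denom A z

/-- The complex Jacobian J(A,z) = (denominator)^{-(n+1)}. -/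
def jac (A : Matrix (Fin (n + 1)) (Fin (n + 1)) ℂ) (z : Fin n → ℂ) : ℂ :=
  (denom A z)⁻¹ ^ (n + 1)

/-- The Bergman kernel K(z,w) = (n!/πⁿ) (−⟨z,w⟩)^{−(n+1)}. -/
def Kc (z w : Fin n → ℂ) : ℂ :=
  (((Nat.factorial n : ℝ) / Real.pi ^ n : ℝ) : ℂ) * (-(pair z w))⁻¹ ^ (n + 1)

/-- K(z,z) as a real-valued function: K(z,z) = (n!/πⁿ) (1−|z|²)^{−(n+1)}. -/
def Kr (z : Fin n → ℂ) : ℝ :=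
  (Nat.factorial n : ℝ) / Real.pi ^ n * ((1 - ∑ i, ‖z i‖ ^ 2)⁻¹) ^ (n + 1)

/-- c(𝔹ⁿ,k) = C((n+1)(k−1)+n, n). -/
def cB (n k : ℕ) : ℕ := Nat.choose ((n + 1) * (k - 1) + n) n

/-- The last index of Fin n. -/
def lastI (n : ℕ) (hn : 0 < n) : Fin n := ⟨n - 1, by omega⟩

/-- The geodesic C̃₀ = {z ∈ 𝔹ⁿ : z₁ = ... = z_{n−1} = 0, zₙ ∈ (−1,1) real}. -/
def geo0 (n : ℕ) (hn : 0 < n) : Set (Fin n → ℂ) :=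
  {z | (∀ i : Fin n, (i : ℕ) < n - 1 → z i = 0) ∧ (z (lastI n hn)).im = 0 ∧
    -1 < (z (lastI n hn)).re ∧ (z (lastI n hn)).re < 1}

/-- The point (0,...,0,x) of C̃₀. -/
def curve (n : ℕ) (hn : 0 < n) (x : ℝ) : Fin n → ℂ :=
  fun i => if i = lastI n hn then (x : ℂ) else 0

/-- The vector (X,1) ∈ ℂ^{n+1}. -/
def snoc1 (X : Fin n → ℂ) : Fin (n + 1) → ℂ := Fin.snoc X 1

/-- The matrix A_γ, with columns v₁,...,v_{n−1},
⟨X,Y⟩⁻¹(X,1) + (1/2)(Y,1), ⟨X,Y⟩⁻¹(X,1) − (1/2)(Y,1). -/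
def Amat (n : ℕ) (v : Fin (n - 1) → Fin (n + 1) → ℂ) (X Y : Fin n → ℂ) :
    Matrix (Fin (n + 1)) (Fin (n + 1)) ℂ :=
  Matrix.of fun i j =>
    if h : (j : ℕ) < n - 1 then v ⟨j, h⟩ i
    else if (j : ℕ) = n - 1 then ((pair X Y)⁻¹ • snoc1 X + (2 : ℂ)⁻¹ • snoc1 Y) i
    else ((pair X Y)⁻¹ • snoc1 X - (2 : ℂ)⁻¹ • snoc1 Y) i

/-- σ = diag(1,...,1,−1). -/
def sigmaM (n : ℕ) : Matrix (Fin (n + 1)) (Fin (n + 1)) ℂ :=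
  Matrix.diagonal fun i => if i = Fin.last n then -1 else 1

/-- Inverse hyperbolic cosine. -/
def arcosh (x : ℝ) : ℝ := Real.log (x + Real.sqrt (x ^ 2 - 1))

/-- Inverse hyperbolic tangent. -/
def artanh (x : ℝ) : ℝ := Real.log ((1 + x) / (1 - x)) / 2

/-- The hyperbolic (Bergman) distance on the ball, determined by
cosh²(ρ(z,w)/2) = ⟨z,w⟩⟨w,z⟩/(⟨z,z⟩⟨w,w⟩). -/
def rho (z w : Fin n → ℂ) : ℝ :=
  2 * arcosh (Real.sqrt ((pair z w * pair w z).re / (pair z z * pair w w).re))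

/-- A discrete subgroup Γ of SU(n,1) acting freely on the ball with compact quotient. -/
structure DiscreteGroup (n : ℕ) where
  Γ : Set (Matrix (Fin (n + 1)) (Fin (n + 1)) ℂ)
  sub_SU : Γ ⊆ SU n
  one_mem : 1 ∈ Γ
  mul_mem : ∀ {A B}, A ∈ Γ → B ∈ Γ → A * B ∈ Γ
  inv_mem : ∀ {A}, A ∈ Γ → A⁻¹ ∈ Γ
  discrete : DiscreteTopology ↥Γ
  free : ∀ A ∈ Γ, (∃ z ∈ ball n, act A z = z) → A = 1
  cocompact : ∃ F : Set (Fin n → ℂ), F ⊆ ball n ∧ IsCompact F ∧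
    ∀ z ∈ ball n, ∃ A ∈ Γ, act A z ∈ F

/-- A hyperbolic element γ of Γ, with real eigenvalues, real fixed points X, Y on the
boundary, eigenvalue data λ, and the eigenvectors v₁,...,v_{n−1} for eigenvalues ±1,
orthonormal with respect to the form ⟨⟨.,.⟩⟩. -/
structure HypElt (n : ℕ) (G : DiscreteGroup n) where
  γ : Matrix (Fin (n + 1)) (Fin (n + 1)) ℂ
  mem : γ ∈ G.Γ
  ne_one : γ ≠ 1
  eig_real : ∀ μ ∈ spectrum ℂ γ, μ.im = 0
  X : Fin n → ℂ
  Y : Fin n → ℂ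
  X_bd : ∑ i, ‖X i‖ ^ 2 = 1
  Y_bd : ∑ i, ‖Y i‖ ^ 2 = 1
  X_real : ∀ i, (X i).im = 0
  Y_real : ∀ i, (Y i).im = 0
  lam : ℝ
  lam_sq : 1 < lam ^ 2
  eigX : γ.mulVec (snoc1 X) = (lam : ℂ) • snoc1 X
  eigY : γ.mulVec (snoc1 Y) = ((lam : ℂ))⁻¹ • snoc1 Y
  primitive : ∀ A ∈ G.Γ, ∀ m : ℕ, 2 ≤ m → A ^ m ≠ γ
  v : Fin (n - 1) → Fin (n + 1) → ℂ
  alph : Fin (n - 1) → ℂ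
  alph_pm : ∀ j, alph j = 1 ∨ alph j = -1
  v_eig : ∀ j, γ.mulVec (v j) = alph j • v j
  v_on : ∀ j l, herm (v j) (v l) = if j = l then 1 else 0

variable {G : DiscreteGroup n}

/-- The matrix A_γ associated to the hyperbolic element γ. -/
def HypElt.A (H : HypElt n G) : Matrix (Fin (n + 1)) (Fin (n + 1)) ℂ :=
  Amat n H.v H.X H.Y

/-- γ₀ = A_γ⁻¹ γ A_γ. -/
def HypElt.g0 (H : HypElt n G) : Matrix (Fin (n + 1)) (Fin (n + 1)) ℂ :=
  (H.A)⁻¹ * H.γ * H.A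

/-- T = (λ²−1)/(λ²+1), the last coordinate of γ₀(0). -/
def HypElt.T (H : HypElt n G) : ℝ := (H.lam ^ 2 - 1) / (H.lam ^ 2 + 1)

/-- The geodesic C̃ in 𝔹ⁿ with endpoints X, Y, as the image of C̃₀ under A_γ. -/
def HypElt.Ct (H : HypElt n G) (hn : 0 < n) : Set (Fin n → ℂ) :=
  act H.A '' geo0 n hn

/-- The length l(C) of the closed geodesic C, the hyperbolic distance from 0 to γ₀(0). -/
def HypElt.lenC (H : HypElt n G) : ℝ :=
  rho (0 : Fin n → ℂ) (act H.g0 (0 : Fin n → ℂ))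

/-- A (measure-theoretic) fundamental domain for the action of Γ on the ball. -/
def IsFundDom (G : DiscreteGroup n) (F : Set (Fin n → ℂ)) : Prop :=
  F ⊆ ball n ∧ MeasurableSet F ∧ (∀ z ∈ ball n, ∃ A ∈ G.Γ, act A z ∈ F) ∧
    ∀ A ∈ G.Γ, A ≠ 1 → volume {z ∈ F | act A z ∈ F} = 0

/-- The automorphy condition f(Az) J(A,z)^k = f(z). -/
def Automorphic (G : DiscreteGroup n) (k : ℕ) (f : (Fin n → ℂ) → ℂ) : Prop :=
  ∀ A ∈ G.Γ, ∀ z ∈ ball n, f (act A z) * jac A z ^ k = f z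

/-- Membership in H̃⁰_Γ(k): holomorphic on the ball and automorphic of weight k. -/
def Htilde (G : DiscreteGroup n) (k : ℕ) (f : (Fin n → ℂ) → ℂ) : Prop :=
  DifferentiableOn ℂ f (ball n) ∧ Automorphic G k f

/-- The inner product (f,g) = ∫_M f ḡ K(z,z)^{−k} dV = ∫_F f ḡ K(z,z)^{1−k} dV_e,
computed over a fundamental domain F. -/
def iprod (F : Set (Fin n → ℂ)) (k : ℕ) (f g : (Fin n → ℂ) → ℂ) : ℂ :=
  ∫ z in F, f z * star (g z) * ((Kr z ^ ((1 : ℤ) - (k : ℤ)) : ℝ) : ℂ)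

/-- The Poincaré series Θ_w^{(k)}(z) = c(𝔹ⁿ,k) Σ_{A∈Γ} K(Az,w)^k J(A,z)^k. -/
def ThetaPt (G : DiscreteGroup n) (k : ℕ) (w z : Fin n → ℂ) : ℂ :=
  (cB n k : ℂ) * ∑' A : ↥G.Γ, Kc (act (A : Matrix (Fin (n + 1)) (Fin (n + 1)) ℂ) z) w ^ k *
    jac (A : Matrix (Fin (n + 1)) (Fin (n + 1)) ℂ) z ^ k

/-- The relative Poincaré series
Θ_C^{(k)}(z) = ∫_C Θ_w^{(k)}(z) K(w,w)^{−k/2} ((A_γ⁻¹)*φ)(w), written out over one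
period of C̃, parametrized by w = A_γ(0,...,0,x), x ∈ [0,T]. -/
def ThetaC (hn : 0 < n) (H : HypElt n G) (k : ℕ) (z : Fin n → ℂ) : ℂ :=
  ∫ x in (0 : ℝ)..H.T, ThetaPt G k (act H.A (curve n hn x)) z *
    ((Kr (act H.A (curve n hn x)) ^ (-(k : ℝ) / 2) : ℝ) : ℂ) *
    ((Kr (curve n hn x) ^ (((n : ℝ) + 1))⁻¹ : ℝ) : ℂ)

/-- The set of integer powers of a matrix. -/
def zpows (g : Matrix (Fin (n + 1)) (Fin (n + 1)) ℂ) :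
    Set (Matrix (Fin (n + 1)) (Fin (n + 1)) ℂ) := {h | ∃ m : ℤ, h = g ^ m}

/-- The conjugate group A_γ⁻¹ Γ A_γ. -/
def conjGrp (G : DiscreteGroup n) (H : HypElt n G) :
    Set (Matrix (Fin (n + 1)) (Fin (n + 1)) ℂ) :=
  (fun g => (H.A)⁻¹ * g * H.A) '' G.Γ

end

end BallPaper

namespace BallPaper

/-- The squared Euclidean norm of the first `n` coordinates. -/
noncomputable def spn {n : ℕ} (u : Fin (n + 1) → ℂ) : ℝ := ∑ i : Fin n, ‖u i.castSucc‖ ^ 2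

/-- The quadratic form of `herm`, as a real number. -/
noncomputable def qf {n : ℕ} (u : Fin (n + 1) → ℂ) : ℝ := spn u - ‖u (Fin.last n)‖ ^ 2

section Form

variable {n : ℕ}

lemma spn_nonneg (u : Fin (n + 1) → ℂ) : 0 ≤ spn u :=
  Finset.sum_nonneg fun _ _ => by positivity

lemma herm_self (u : Fin (n + 1) → ℂ) : herm u u = (qf u : ℂ) := by
  have h (z : ℂ) : z * star z = ((‖z‖ ^ 2 : ℝ) : ℂ) := by
    rw [Complex.star_def, Complex.mul_conj, Complex.normSq_eq_norm_sq]
  simp only [herm, qf, spn, h]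
  push_cast
  rfl

lemma herm_add_left (u u' v : Fin (n + 1) → ℂ) : herm (u + u') v = herm u v + herm u' v := by
  simp only [herm, Pi.add_apply, add_mul, Finset.sum_add_distrib]
  ring

lemma herm_smul_left (c : ℂ) (u v : Fin (n + 1) → ℂ) : herm (c • u) v = c * herm u v := by
  simp only [herm, Pi.smul_apply, smul_eq_mul, mul_assoc, ← Finset.mul_sum, mul_sub]

lemma star_herm (u v : Fin (n + 1) → ℂ) : star (herm u v) = herm v u := by
  simp only [herm, star_sub, star_sum, star_mul, star_star]

lemma herm_add_right (u v v' : Fin (n + 1) → ℂ) : herm u (v + v') = herm u v + herm u v' := by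
  rw [← star_herm, herm_add_left, star_add, star_herm, star_herm]

lemma herm_smul_right (c : ℂ) (u v : Fin (n + 1) → ℂ) :
    herm u (c • v) = star c * herm u v := by
  rw [← star_herm, herm_smul_left, star_mul, star_herm, mul_comm]

lemma norm_sum_mul_star_le (u v : Fin (n + 1) → ℂ) :
    ‖∑ i : Fin n, u i.castSucc * star (v i.castSucc)‖ ≤ √(spn u) * √(spn v) := by
  refine (norm_sum_le _ _).trans ?_
  simp only [norm_mul, norm_star]
  exact Real.sum_mul_le_sqrt_mul_sqrt _ _ _

lemma le_norm_herm {a : Fin (n + 1) → ℂ} (ha : qf a ≤ 0) (v : Fin (n + 1) → ℂ) :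
    ‖a (Fin.last n)‖ * (‖v (Fin.last n)‖ - √(spn v)) ≤ ‖herm a v‖ := by
  have h1 : √(spn a) ≤ ‖a (Fin.last n)‖ := by
    refine Real.sqrt_le_iff.2 ⟨norm_nonneg _, ?_⟩
    unfold qf at ha
    linarith
  have h2 := norm_sum_mul_star_le a v
  have h3 := norm_sub_norm_le (a (Fin.last n) * star (v (Fin.last n)))
    (∑ i : Fin n, a i.castSucc * star (v i.castSucc))
  rw [norm_sub_rev, norm_mul, norm_star] at h3
  have h4 := mul_le_mul_of_nonneg_right h1 (Real.sqrt_nonneg (spn v))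
  unfold herm
  linarith

/-- A vector orthogonal to a negative vector is zero or positive. -/
lemma eq_zero_of_orthogonal {u w : Fin (n + 1) → ℂ} (hu : qf u < 0) (h : herm w u = 0)
    (hw : qf w ≤ 0) : w = 0 := by
  have h1 := le_norm_herm hw u
  rw [h, norm_zero] at h1
  have h2 : √(spn u) < ‖u (Fin.last n)‖ := by
    have h3 : 0 ≤ ‖u (Fin.last n)‖ := norm_nonneg _
    rw [← Real.sqrt_sq h3]
    refine Real.sqrt_lt_sqrt (spn_nonneg u) ?_
    unfold qf at hu
    linarith
  have h3 : ‖w (Fin.last n)‖ = 0 := by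
    by_contra h4
    have : 0 < ‖w (Fin.last n)‖ := lt_of_le_of_ne (norm_nonneg _) (Ne.symm h4)
    have := mul_pos this (sub_pos.2 h2)
    linarith
  have h5 : spn w = 0 := by
    refine le_antisymm ?_ (spn_nonneg w)
    unfold qf at hw
    rw [h3] at hw
    linarith
  have h6 := (Finset.sum_eq_zero_iff_of_nonneg fun i _ => by positivity).1 h5
  funext i
  refine Fin.lastCases (by simpa using h3) (fun j => ?_) i
  simpa using h6 j (Finset.mem_univ _)

/-- The equality case of the reverse Cauchy-Schwarz inequality. -/
lemma exists_eq_smul_of_norm_herm_le {u v : Fin (n + 1) → ℂ} (hu : qf u < 0)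
    (h : ‖herm v u‖ ^ 2 ≤ qf v * qf u) : ∃ c : ℂ, v = c • u := by
  have hne : (qf u : ℂ) ≠ 0 := by exact_mod_cast hu.ne
  set c : ℂ := herm v u / (qf u : ℂ) with hc
  refine ⟨c, ?_⟩
  have h1 : herm (v + (-c) • u) u = 0 := by
    rw [herm_add_left, herm_smul_left, herm_self, hc]
    field_simp
    ring
  have h2 : herm (v + (-c) • u) (v + (-c) • u) = ((qf v - ‖herm v u‖ ^ 2 / qf u : ℝ) : ℂ) := by
    rw [herm_add_right, herm_smul_right, h1, herm_add_left, herm_smul_left, herm_self,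
      ← star_herm v u, hc]
    have : herm v u * star (herm v u) = ((‖herm v u‖ ^ 2 : ℝ) : ℂ) := by
      rw [Complex.star_def, Complex.mul_conj, Complex.normSq_eq_norm_sq]
    push_cast at this ⊢
    rw [← this]
    ring
  rw [herm_self] at h2
  have h3 : qf (v + (-c) • u) ≤ 0 := by
    rw [Complex.ofReal_injective h2, sub_nonpos, le_div_iff_of_neg hu]
    exact h
  have h4 := eq_zero_of_orthogonal hu h1 h3
  rw [neg_smul, ← sub_eq_add_neg, sub_eq_zero] at h4
  exact h4

end Form

section Unitary

variable {n : ℕ} {A : Matrix (Fin (n + 1)) (Fin (n + 1)) ℂ}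

lemma isUnit_det_of_mem_SU (hA : A ∈ SU n) : IsUnit A.det := by
  rw [hA.1]
  exact isUnit_one

lemma qf_mulVec (hA : A ∈ SU n) (u : Fin (n + 1) → ℂ) : qf (A *ᵥ u) = qf u := by
  have := hA.2 u u
  rw [herm_self, herm_self] at this
  exact_mod_cast this

lemma inv_mem_SU (hA : A ∈ SU n) : A⁻¹ ∈ SU n := by
  have hd := isUnit_det_of_mem_SU hA
  refine ⟨by simp [Matrix.det_nonsing_inv, hA.1], fun u v => ?_⟩
  rw [← hA.2, Matrix.mulVec_mulVec, Matrix.mulVec_mulVec, Matrix.mul_nonsing_inv _ hd,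
    Matrix.one_mulVec, Matrix.one_mulVec]

lemma herm_mulVec_left (hA : A ∈ SU n) (u v : Fin (n + 1) → ℂ) :
    herm (A *ᵥ u) v = herm u (A⁻¹ *ᵥ v) := by
  rw [← hA.2 u, Matrix.mulVec_mulVec, Matrix.mul_nonsing_inv _ (isUnit_det_of_mem_SU hA),
    Matrix.one_mulVec]

lemma herm_single_last (u : Fin (n + 1) → ℂ) :
    herm u (Pi.single (Fin.last n) 1) = -u (Fin.last n) := by
  simp [herm, Fin.castSucc_ne_last]

lemma qf_single_last : qf (Pi.single (Fin.last n) 1 : Fin (n + 1) → ℂ) = -1 := by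
  have := herm_single_last (n := n) (Pi.single (Fin.last n) 1)
  rw [herm_self] at this
  simp only [Pi.single_eq_same] at this
  exact_mod_cast this

lemma norm_le_of_qf {a : Fin (n + 1) → ℂ} {r : ℝ} (hr : 0 ≤ r)
    (ha : qf a + ‖a (Fin.last n)‖ ^ 2 ≤ r ^ 2) (i : Fin n) : ‖a i.castSucc‖ ≤ r := by
  have h1 : ‖a i.castSucc‖ ^ 2 ≤ spn a :=
    Finset.single_le_sum (f := fun i : Fin n => ‖a i.castSucc‖ ^ 2)
      (fun _ _ => by positivity) (Finset.mem_univ i)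
  unfold qf at ha
  exact abs_le_of_sq_le_sq' (by linarith) hr |>.2

lemma norm_inv_last_last (hA : A ∈ SU n) :
    ‖A⁻¹ (Fin.last n) (Fin.last n)‖ = ‖A (Fin.last n) (Fin.last n)‖ := by
  have h := herm_mulVec_left hA (Pi.single (Fin.last n) 1) (Pi.single (Fin.last n) 1)
  rw [herm_single_last, ← star_herm, herm_single_last] at h
  have := congrArg norm h
  simpa using this.symm

lemma norm_col_last_le (hA : A ∈ SU n) (i : Fin n) :
    ‖A i.castSucc (Fin.last n)‖ ^ 2 ≤ ‖A (Fin.last n) (Fin.last n)‖ ^ 2 - 1 := by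
  have h1 := qf_mulVec hA (Pi.single (Fin.last n) 1)
  rw [qf_single_last] at h1
  have h2 : ‖(A *ᵥ Pi.single (Fin.last n) 1) i.castSucc‖ ^ 2 ≤
      spn (A *ᵥ Pi.single (Fin.last n) 1) :=
    Finset.single_le_sum
      (f := fun i : Fin n => ‖(A *ᵥ Pi.single (Fin.last n) 1) i.castSucc‖ ^ 2)
      (fun _ _ => by positivity) (Finset.mem_univ i)
  unfold qf at h1
  simp only [Matrix.mulVec_single_one, Matrix.col_apply] at h1 h2
  linarith

lemma one_le_norm_last_last (hA : A ∈ SU n) : 1 ≤ ‖A (Fin.last n) (Fin.last n)‖ := by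
  have h1 := qf_mulVec hA (Pi.single (Fin.last n) 1)
  rw [qf_single_last] at h1
  have h2 := spn_nonneg (A *ᵥ Pi.single (Fin.last n) 1)
  unfold qf at h1
  simp only [Matrix.mulVec_single_one, Matrix.col_apply] at h1 h2
  have h3 := norm_nonneg (A (Fin.last n) (Fin.last n))
  nlinarith

lemma norm_row_last_le (hA : A ∈ SU n) (j : Fin n) :
    ‖A (Fin.last n) j.castSucc‖ ^ 2 ≤ ‖A (Fin.last n) (Fin.last n)‖ ^ 2 - 1 := by
  have h1 := norm_col_last_le (inv_mem_SU hA) j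
  rw [norm_inv_last_last hA] at h1
  have h := herm_mulVec_left hA (Pi.single j.castSucc 1) (Pi.single (Fin.last n) 1)
  rw [herm_single_last] at h
  have h2 : ‖A (Fin.last n) j.castSucc‖ = ‖A⁻¹ j.castSucc (Fin.last n)‖ := by
    have h3 := congrArg norm h
    simp only [herm, Matrix.mulVec_single_one, Matrix.col_apply, norm_neg] at h3
    rw [h3, Finset.sum_eq_single j]
    · simp [(Fin.castSucc_lt_last j).ne']
    · intro b _ hb
      simp [hb]
    · simp
  rw [h2]
  exact h1

/-- The bottom right entry dominates all entries of an element of `SU(n,1)`. -/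
lemma norm_entry_le (hA : A ∈ SU n) (i j : Fin (n + 1)) :
    ‖A i j‖ ≤ ‖A (Fin.last n) (Fin.last n)‖ := by
  have h0 := norm_nonneg (A (Fin.last n) (Fin.last n))
  refine Fin.lastCases ?_ (fun j => ?_) j
  · refine Fin.lastCases le_rfl (fun i => ?_) i
    exact abs_le_of_sq_le_sq' (by linarith [norm_col_last_le hA i]) h0 |>.2
  · refine Fin.lastCases ?_ (fun i => ?_) i
    · exact abs_le_of_sq_le_sq' (by linarith [norm_row_last_le hA j]) h0 |>.2
    · have h1 := qf_mulVec hA (Pi.single j.castSucc 1)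
      have h2 : qf (Pi.single j.castSucc 1 : Fin (n + 1) → ℂ) = 1 := by
        unfold qf spn
        rw [Finset.sum_eq_single j]
        · simp [(Fin.castSucc_lt_last j).ne']
        · intro b _ hb
          simp [hb]
        · simp
      have h3 := norm_le_of_qf (a := A *ᵥ Pi.single j.castSucc 1) h0 (by
        rw [h1, h2]
        simp only [Matrix.mulVec_single_one, Matrix.col_apply]
        linarith [norm_row_last_le hA j]) i
      simpa using h3

lemma le_norm_mulVec_last (hA : A ∈ SU n) (u : Fin (n + 1) → ℂ) :
    ‖A (Fin.last n) (Fin.last n)‖ * (‖u (Fin.last n)‖ - √(spn u)) ≤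
      ‖(A *ᵥ u) (Fin.last n)‖ := by
  have h1 : qf (A⁻¹ *ᵥ Pi.single (Fin.last n) 1) ≤ 0 := by
    rw [qf_mulVec (inv_mem_SU hA), qf_single_last]
    norm_num
  have h2 := le_norm_herm h1 u
  have h3 := herm_mulVec_left hA u (Pi.single (Fin.last n) 1)
  rw [herm_single_last] at h3
  rw [← star_herm, norm_star, ← h3, norm_neg] at h2
  simpa [norm_inv_last_last hA] using h2

lemma sqrt_spn_lt {u : Fin (n + 1) → ℂ} (hu : qf u < 0) : √(spn u) < ‖u (Fin.last n)‖ := by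
  rw [← Real.sqrt_sq (norm_nonneg (u (Fin.last n)))]
  refine Real.sqrt_lt_sqrt (spn_nonneg u) ?_
  unfold qf at hu
  linarith

end Unitary

end BallPaper

namespace BallPaper

section Action

variable {n : ℕ} {A : Matrix (Fin (n + 1)) (Fin (n + 1)) ℂ}

@[simp] lemma snoc1_castSucc (z : Fin n → ℂ) (i : Fin n) : snoc1 z i.castSucc = z i := by
  simp [snoc1]

@[simp] lemma snoc1_last (z : Fin n → ℂ) : snoc1 z (Fin.last n) = 1 := by
  simp [snoc1]

lemma herm_snoc1 (z w : Fin n → ℂ) : herm (snoc1 z) (snoc1 w) = pair z w := by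
  simp [herm, pair]

lemma qf_snoc1 (z : Fin n → ℂ) : qf (snoc1 z) = ∑ i, ‖z i‖ ^ 2 - 1 := by
  simp [qf, spn]

lemma mem_ball_iff_qf (z : Fin n → ℂ) : z ∈ ball n ↔ qf (snoc1 z) < 0 := by
  rw [qf_snoc1, sub_neg]
  rfl

lemma mulVec_snoc1_last (A : Matrix (Fin (n + 1)) (Fin (n + 1)) ℂ) (z : Fin n → ℂ) :
    (A *ᵥ snoc1 z) (Fin.last n) = denom A z := by
  simp [Matrix.mulVec, dotProduct, Fin.sum_univ_castSucc, denom]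

lemma mulVec_snoc1_castSucc (A : Matrix (Fin (n + 1)) (Fin (n + 1)) ℂ) (z : Fin n → ℂ)
    (i : Fin n) : (A *ᵥ snoc1 z) i.castSucc = act A z i * denom A z ∨ denom A z = 0 := by
  by_cases h : denom A z = 0
  · exact Or.inr h
  · left
    simp only [act]
    rw [div_mul_cancel₀ _ h]
    simp [Matrix.mulVec, dotProduct, Fin.sum_univ_castSucc]

lemma mulVec_snoc1 (h : denom A z ≠ 0) : A *ᵥ snoc1 z = denom A z • snoc1 (act A z) := by
  funext i
  refine Fin.lastCases ?_ (fun i => ?_) i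
  · simp [mulVec_snoc1_last]
  · rcases mulVec_snoc1_castSucc A z i with h' | h'
    · simp [h', mul_comm]
    · exact absurd h' h

lemma last_ne_zero_of_qf_neg {u : Fin (n + 1) → ℂ} (hu : qf u < 0) : u (Fin.last n) ≠ 0 := by
  have h1 := sqrt_spn_lt hu
  have h2 := Real.sqrt_nonneg (spn u)
  exact norm_pos_iff.1 (by linarith)

lemma denom_ne_zero (hA : A ∈ SU n) {z : Fin n → ℂ} (hz : z ∈ ball n) : denom A z ≠ 0 := by
  rw [← mulVec_snoc1_last]
  refine last_ne_zero_of_qf_neg ?_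
  rw [qf_mulVec hA]
  exact (mem_ball_iff_qf z).1 hz

lemma qf_smul (c : ℂ) (u : Fin (n + 1) → ℂ) : qf (c • u) = ‖c‖ ^ 2 * qf u := by
  simp only [qf, spn, Pi.smul_apply, smul_eq_mul, norm_mul, mul_pow, ← Finset.mul_sum]
  ring

lemma exists_eq_smul_snoc1 {u : Fin (n + 1) → ℂ} (hu : u (Fin.last n) ≠ 0) :
    u = u (Fin.last n) • snoc1 (fun i => u i.castSucc / u (Fin.last n)) := by
  funext i
  refine Fin.lastCases ?_ (fun i => ?_) i
  · simp
  · simp [mul_div_cancel₀ _ hu]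

/-- A group element with a negative eigenvector fixes a point of the ball, hence is trivial. -/
lemma DiscreteGroup.eq_one_of_eigenvector (G : DiscreteGroup n) (hA : A ∈ G.Γ)
    {u : Fin (n + 1) → ℂ} (hu : qf u < 0) {c : ℂ} (h : A *ᵥ u = c • u) : A = 1 := by
  have hl := last_ne_zero_of_qf_neg hu
  set z : Fin n → ℂ := fun i => u i.castSucc / u (Fin.last n) with hz
  have hu' : u = u (Fin.last n) • snoc1 z := exists_eq_smul_snoc1 hl
  have hzb : z ∈ ball n := by
    rw [mem_ball_iff_qf]
    rw [hu', qf_smul] at hu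
    by_contra h0
    exact absurd hu (not_lt.2 (mul_nonneg (by positivity) (not_lt.1 h0)))
  refine G.free A hA ⟨z, hzb, ?_⟩
  have hd := denom_ne_zero (G.sub_SU hA) hzb
  have h1 : A *ᵥ snoc1 z = c • snoc1 z := by
    rw [hu', Matrix.mulVec_smul, smul_comm] at h
    exact smul_right_injective _ hl h
  rw [mulVec_snoc1 hd] at h1
  have h2 := congrFun h1 (Fin.last n)
  simp only [Pi.smul_apply, snoc1_last, smul_eq_mul, mul_one] at h2
  funext i
  have h3 := congrFun h1 i.castSucc
  simp only [Pi.smul_apply, snoc1_castSucc, smul_eq_mul, ← h2] at h3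
  exact mul_left_cancel₀ hd h3

end Action

section NullPair

variable {n : ℕ} {A : Matrix (Fin (n + 1)) (Fin (n + 1)) ℂ}

/-- Two null vectors spanning a hyperbolic plane. -/
structure NullPair {n : ℕ} (X Y : Fin (n + 1) → ℂ) (P : ℝ) : Prop where
  left : herm X X = 0
  right : herm Y Y = 0
  pairing : herm X Y = P
  neg : P < 0

variable {X Y : Fin (n + 1) → ℂ} {P : ℝ}

lemma NullPair.pairing' (h : NullPair X Y P) : herm Y X = P := by
  rw [← star_herm, h.pairing]
  exact Complex.conj_ofReal P

lemma NullPair.herm_comb (h : NullPair X Y P) (a b c d : ℂ) :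
    herm (a • X + b • Y) (c • X + d • Y) = P * (a * star d + b * star c) := by
  simp only [herm_add_left, herm_add_right, herm_smul_left, herm_smul_right, h.left, h.right,
    h.pairing, h.pairing']
  ring

lemma NullPair.qf_comb (h : NullPair X Y P) (a b : ℝ) :
    qf ((a : ℂ) • X + (b : ℂ) • Y) = 2 * P * (a * b) := by
  have h1 := h.herm_comb a b a b
  rw [herm_self] at h1
  simp only [Complex.star_def, Complex.conj_ofReal] at h1
  have h2 : qf ((a : ℂ) • X + (b : ℂ) • Y) = P * (a * b + b * a) := by exact_mod_cast h1
  rw [h2]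
  ring

lemma NullPair.coeff_right (h : NullPair X Y P) (c : ℂ) (s : ℝ) (r : ℝ)
    (h0 : herm ((c * r) • X + (c * s) • Y) ((c * r) • X + (c * s) • Y) = 0) (hc : c ≠ 0) :
    r = 0 ∨ s = 0 := by
  rw [h.herm_comb] at h0
  have hP : (P : ℂ) ≠ 0 := by exact_mod_cast h.neg.ne
  have hcc : star c ≠ 0 := by simpa using hc
  have h1 : (P : ℂ) * c * star c * 2 * (r * s : ℝ) = 0 := by
    rw [← h0]
    simp only [star_mul', Complex.star_def, Complex.conj_ofReal]
    push_cast
    ring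
  have h2 : ((r * s : ℝ) : ℂ) = 0 := by
    simpa [hP, hc, hcc] using h1
  exact mul_eq_zero.1 (by exact_mod_cast h2)

/-- A unitary map sending two points of a geodesic into this geodesic
permutes its end points. -/
lemma NullPair.permutes_of_two_points (h : NullPair X Y P) (hA : A ∈ SU n) {t t' s s' : ℝ}
    (ht : 0 < t) (ht' : 0 < t') (htt : t ≠ t') (hs : 0 < s) (hs' : 0 < s') {c c' : ℂ}
    (h1 : A *ᵥ (X + (t : ℂ) • Y) = c • (X + (s : ℂ) • Y))
    (h2 : A *ᵥ (X + (t' : ℂ) • Y) = c' • (X + (s' : ℂ) • Y)) :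
    (∃ a b : ℂ, A *ᵥ X = a • X ∧ A *ᵥ Y = b • Y) ∨
      ∃ a b : ℂ, A *ᵥ X = a • Y ∧ A *ᵥ Y = b • X := by
  have hP : (P : ℂ) ≠ 0 := by exact_mod_cast h.neg.ne
  have e1 (t : ℝ) : X + (t : ℂ) • Y = (1 : ℂ) • X + (t : ℂ) • Y := by rw [one_smul]
  have h3 : c * star c' * ((s + s' : ℝ) : ℂ) = ((t + t' : ℝ) : ℂ) := by
    have h4 := hA.2 (X + (t : ℂ) • Y) (X + (t' : ℂ) • Y)
    rw [h1, h2, herm_smul_left, herm_smul_right, e1, e1, e1, e1, h.herm_comb, h.herm_comb] at h4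
    simp only [Complex.star_def, Complex.conj_ofReal, map_one] at h4 ⊢
    apply mul_left_cancel₀ hP
    push_cast
    linear_combination h4
  have hss : ((s + s' : ℝ) : ℂ) ≠ 0 := by exact_mod_cast (by linarith : (s + s') ≠ 0)
  have htt' : ((t + t' : ℝ) : ℂ) ≠ 0 := by exact_mod_cast (by linarith : (t + t') ≠ 0)
  have hc : c ≠ 0 := by
    rintro rfl
    simp only [zero_mul] at h3
    exact htt' h3.symm
  obtain ⟨ρ, hρ⟩ : ∃ ρ : ℝ, c' = c * ρ := by
    refine ⟨(t + t') / ((s + s') * Complex.normSq c), ?_⟩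
    have hn : (Complex.normSq c : ℂ) ≠ 0 := by
      exact_mod_cast (Complex.normSq_pos.2 hc).ne'
    have h5 := congrArg star h3
    simp only [star_mul', Complex.star_def, Complex.conj_ofReal, Complex.conj_conj] at h5
    have h6 : c * (starRingEnd ℂ) c = (Complex.normSq c : ℂ) := Complex.mul_conj c
    push_cast at h5 hss ⊢
    field_simp
    rw [← h5, ← h6]
    ring
  set k : ℝ := (t - t')⁻¹ with hk
  have hkt : k * (t - t') = 1 := inv_mul_cancel₀ (sub_ne_zero.2 htt)
  have hktC : (k : ℂ) * ((t : ℂ) - t') = 1 := by exact_mod_cast hkt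
  have hY : A *ᵥ Y = (c * ((k * (1 - ρ) : ℝ) : ℂ)) • X +
      (c * ((k * (s - ρ * s') : ℝ) : ℂ)) • Y := by
    have h7 : A *ᵥ Y = (k : ℂ) • (A *ᵥ (X + (t : ℂ) • Y) - A *ᵥ (X + (t' : ℂ) • Y)) := by
      rw [← Matrix.mulVec_sub, ← Matrix.mulVec_smul]
      congr 1
      rw [add_sub_add_left_eq_sub, ← sub_smul, smul_smul, hktC, one_smul]
    rw [h7, h1, h2, hρ]
    push_cast
    module
  have hX : A *ᵥ X = (c * ((1 - t * (k * (1 - ρ)) : ℝ) : ℂ)) • X +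
      (c * ((s - t * (k * (s - ρ * s')) : ℝ) : ℂ)) • Y := by
    have h7 : A *ᵥ X = A *ᵥ (X + (t : ℂ) • Y) - (t : ℂ) • A *ᵥ Y := by
      rw [← Matrix.mulVec_smul, ← Matrix.mulVec_sub, add_sub_cancel_right]
    rw [h7, h1, hY]
    push_cast
    module
  have nX := hA.2 X X
  have nY := hA.2 Y Y
  rw [h.left, hX] at nX
  rw [h.right, hY] at nY
  have kne : k ≠ 0 := inv_ne_zero (sub_ne_zero.2 htt)
  rcases h.coeff_right c _ _ nY hc with hy | hy
  · have hρ1 : 1 - ρ = 0 := by simpa [kne] using hy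
    left
    have hx : s - t * (k * (s - ρ * s')) = 0 := by
      rcases h.coeff_right c _ _ nX hc with hx | hx
      · rw [hρ1] at hx
        norm_num at hx
      · exact hx
    rw [hx] at hX
    rw [hy] at hY
    exact ⟨_, _, by simpa using hX, by simpa using hY⟩
  · have hρ1 : s - ρ * s' = 0 := by simpa [kne] using hy
    right
    have hx : 1 - t * (k * (1 - ρ)) = 0 := by
      rcases h.coeff_right c _ _ nX hc with hx | hx
      · exact hx
      · rw [hρ1] at hx
        simp only [mul_zero, sub_zero] at hx
        exact absurd hx hs.ne'
    rw [hx] at hX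
    rw [hy] at hY
    exact ⟨_, _, by simpa using hX, by simpa using hY⟩

lemma NullPair.mul_star_eq_one (h : NullPair X Y P) (hA : A ∈ SU n) {a b : ℂ}
    (hX : A *ᵥ X = a • X) (hY : A *ᵥ Y = b • Y) : a * star b = 1 := by
  have hP : (P : ℂ) ≠ 0 := by exact_mod_cast h.neg.ne
  have h1 := hA.2 X Y
  rw [hX, hY, herm_smul_left, herm_smul_right, h.pairing] at h1
  apply mul_left_cancel₀ hP
  linear_combination h1

/-- A discrete group acting freely does not reverse a geodesic. -/
lemma NullPair.not_swap (h : NullPair X Y P) (G : DiscreteGroup n) (hA : A ∈ G.Γ) {a b : ℂ}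
    (hX : A *ᵥ X = a • Y) (hY : A *ᵥ Y = b • X) : False := by
  have hP : (P : ℂ) ≠ 0 := by exact_mod_cast h.neg.ne
  have h1 := (G.sub_SU hA).2 X Y
  rw [hX, hY, herm_smul_left, herm_smul_right, h.pairing, h.pairing'] at h1
  have h2 : a * star b = 1 := by
    apply mul_left_cancel₀ hP
    linear_combination h1
  have ha : a ≠ 0 := by
    rintro rfl
    simp at h2
  have ha' : (‖a‖ : ℂ) ≠ 0 := by exact_mod_cast (norm_pos_iff.2 ha).ne'
  have h4 : b * star a = 1 := by
    have := congrArg star h2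
    simpa [mul_comm] using this
  have h5 : a * star a = (‖a‖ : ℂ) * ‖a‖ := by
    rw [Complex.star_def, Complex.mul_conj, Complex.normSq_eq_norm_sq]
    push_cast
    ring
  have hsa : star a ≠ 0 := by simpa using ha
  have h6 : b * ‖a‖ * ‖a‖ = a := by
    apply mul_right_cancel₀ hsa
    linear_combination (‖a‖ : ℂ) * ‖a‖ * h4 - h5
  have h3 : A *ᵥ (((1 : ℝ) : ℂ) • X + (‖a‖ : ℂ) • Y) =
      (b * ‖a‖) • (((1 : ℝ) : ℂ) • X + (‖a‖ : ℂ) • Y) := by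
    rw [Matrix.mulVec_add, Matrix.mulVec_smul, Matrix.mulVec_smul, hX, hY, smul_add, smul_smul,
      smul_smul, smul_smul, smul_smul, h6]
    push_cast
    module
  have h7 : A = 1 := by
    refine G.eq_one_of_eigenvector hA ?_ h3
    rw [h.qf_comb]
    have := norm_pos_iff.2 ha
    nlinarith [h.neg]
  subst h7
  rw [Matrix.one_mulVec] at hX
  have h8 := h.pairing
  rw [hX, herm_smul_left, h.right, mul_zero] at h8
  exact hP h8.symm

end NullPair

end BallPaper

namespace BallPaper

open Module in
/-- A family whose separation decays at most like the inverse of its size is sparse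
enough for the sum of a high negative power of the sizes to converge. -/
lemma exists_summable_inv_pow_of_separated {ι E : Type*} [NormedAddCommGroup E]
    [NormedSpace ℝ E] [FiniteDimensional ℝ E] (a : ι → E) (h : ι → ℝ) (h1 : ∀ i, 1 ≤ h i)
    (ha : ∀ i, ‖a i‖ ≤ h i) {ε : ℝ} (hε : 0 < ε)
    (sep : ∀ i j, i ≠ j → ε ≤ h i * ‖a i - a j‖) :
    ∃ N : ℕ, Summable fun i => (h i)⁻¹ ^ N := by
  let _ : MeasurableSpace E := borel E
  have : BorelSpace E := ⟨rfl⟩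
  let μ : Measure E := Measure.addHaar
  set D := finrank ℝ E with hD
  set f : E → ℝ := fun x => (1 + ‖x‖) ^ (-((D : ℝ) + 1)) with hf
  have hfi : Integrable f μ := integrable_one_add_norm (by linarith)
  have hf0 : ∀ x, 0 ≤ f x := fun x => Real.rpow_nonneg (by positivity) _
  set δ : ℝ := min (ε / 2) 1 with hδ
  have hδ0 : 0 < δ := by positivity
  have hδε : δ ≤ ε / 2 := min_le_left _ _
  have hδ1 : δ ≤ 1 := min_le_right _ _
  have h0 : ∀ i, 0 < h i := fun i => zero_lt_one.trans_le (h1 i)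
  let U : ι → Set E := fun i => Metric.ball (a i) (δ / h i)
  have hr : ∀ i, 0 < δ / h i := fun i => div_pos hδ0 (h0 i)
  have hdisj : ∀ i j, i ≠ j → Disjoint (U i) (U j) := by
    intro i j hij
    refine Metric.ball_disjoint_ball ?_
    rw [dist_eq_norm]
    have e1 : ε / h i ≤ ‖a i - a j‖ := (div_le_iff₀' (h0 i)).2 (sep i j hij)
    have e2 : ε / h j ≤ ‖a i - a j‖ := by
      rw [norm_sub_rev]
      exact (div_le_iff₀' (h0 j)).2 (sep j i hij.symm)
    have e3 : δ / h i ≤ ε / h i / 2 := by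
      rw [div_right_comm]
      exact div_le_div_of_nonneg_right hδε (h0 i).le
    have e4 : δ / h j ≤ ε / h j / 2 := by
      rw [div_right_comm]
      exact div_le_div_of_nonneg_right hδε (h0 j).le
    linarith
  set V : ℝ := μ.real (Metric.ball (0 : E) 1) with hV
  have hV0 : 0 < V := ENNReal.toReal_pos (Metric.measure_ball_pos μ _ one_pos).ne'
    measure_ball_lt_top.ne
  have hvol : ∀ i, μ.real (U i) = (δ / h i) ^ D * V := by
    intro i
    simp only [U, Measure.real, Measure.addHaar_ball_of_pos μ _ (hr i), ENNReal.toReal_mul, hV]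
    rw [ENNReal.toReal_ofReal (by have := hr i; positivity)]
  have hlow : ∀ i, ∀ x ∈ U i, (3⁻¹ * (h i)⁻¹) ^ (D + 1) ≤ f x := by
    intro i x hx
    have e1 : ‖x‖ ≤ 2 * h i := by
      have e2 : ‖x - a i‖ < δ / h i := by
        rw [← dist_eq_norm]
        exact hx
      have e3 : δ / h i ≤ 1 := (div_le_one (h0 i)).2 (hδ1.trans (h1 i))
      have e4 := norm_add_le (x - a i) (a i)
      rw [sub_add_cancel] at e4
      linarith [ha i, h1 i]
    have e2 : f x = (1 + ‖x‖)⁻¹ ^ (D + 1) := by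
      simp only [hf]
      rw [Real.rpow_neg (by positivity), inv_pow, ← Real.rpow_natCast]
      push_cast
      rfl
    rw [e2]
    have := h0 i
    refine pow_le_pow_left₀ (by positivity) ?_ _
    rw [← mul_inv]
    exact inv_anti₀ (by positivity) (by linarith [h1 i])
  set c : ℝ := 3⁻¹ ^ (D + 1) * (δ ^ D * V) with hc
  have hc0 : 0 < c := by positivity
  refine ⟨2 * D + 1, summable_of_sum_le (c := c⁻¹ * ∫ x, f x ∂μ)
    (fun i => by have := h0 i; positivity) fun s => ?_⟩
  rw [← div_eq_inv_mul, le_div_iff₀' hc0, Finset.mul_sum]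
  calc ∑ i ∈ s, c * (h i)⁻¹ ^ (2 * D + 1)
      ≤ ∑ i ∈ s, ∫ x in U i, f x ∂μ := by
        refine Finset.sum_le_sum fun i _ => ?_
        refine le_trans (le_of_eq ?_) (setIntegral_ge_of_const_le_real
          Metric.isOpen_ball.measurableSet
          measure_ball_lt_top.ne (hlow i) hfi.integrableOn)
        rw [hvol, hc, mul_pow, div_pow, div_eq_mul_inv, ← inv_pow]
        ring
    _ = ∫ x in ⋃ i ∈ s, U i, f x ∂μ := by
        refine (integral_biUnion_finset s (fun i _ => Metric.isOpen_ball.measurableSet)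
          (fun i _ j _ hij => hdisj i j hij) fun i _ => hfi.integrableOn).symm
    _ ≤ ∫ x, f x ∂μ := setIntegral_le_integral hfi (Filter.Eventually.of_forall hf0)

section Counting

variable {n : ℕ} (G : DiscreteGroup n)

lemma DiscreteGroup.exists_isolated : ∃ ε : ℝ, 0 < ε ∧ ∀ A ∈ G.Γ,
    (∀ i j, ‖A i j - (1 : Matrix (Fin (n + 1)) (Fin (n + 1)) ℂ) i j‖ < ε) → A = 1 := by
  have := G.discrete
  obtain ⟨U, hU, hU1⟩ := isOpen_induced_iff.1 (isOpen_discrete ({⟨1, G.one_mem⟩} : Set G.Γ))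
  have hU' : IsOpen (X := Fin (n + 1) → Fin (n + 1) → ℂ) U := hU
  have h1 : (1 : Matrix (Fin (n + 1)) (Fin (n + 1)) ℂ) ∈ U := by
    have : (⟨1, G.one_mem⟩ : G.Γ) ∈ Subtype.val ⁻¹' U := by rw [hU1]; rfl
    exact this
  obtain ⟨ε, hε, hsub⟩ := Metric.isOpen_iff.1 hU' _ h1
  refine ⟨ε, hε, fun A hA h => ?_⟩
  have h2 : (fun i j => A i j : Fin (n + 1) → Fin (n + 1) → ℂ) ∈ Metric.ball
      (fun i j => (1 : Matrix (Fin (n + 1)) (Fin (n + 1)) ℂ) i j) ε := by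
    rw [Metric.mem_ball, dist_pi_lt_iff hε]
    intro i
    rw [dist_pi_lt_iff hε]
    intro j
    rw [dist_eq_norm]
    exact h i j
  have h3 : (⟨A, hA⟩ : G.Γ) ∈ ({⟨1, G.one_mem⟩} : Set G.Γ) := by
    rw [← hU1]
    exact hsub h2
  exact congrArg Subtype.val h3

/-- Convergence of the Poincaré series of high exponent. -/
lemma DiscreteGroup.exists_summable : ∃ N : ℕ, Summable fun A : G.Γ =>
    ‖(A : Matrix (Fin (n + 1)) (Fin (n + 1)) ℂ) (Fin.last n) (Fin.last n)‖⁻¹ ^ N := by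
  obtain ⟨ε, hε, hiso⟩ := G.exists_isolated
  refine exists_summable_inv_pow_of_separated (E := Fin (n + 1) → Fin (n + 1) → ℂ)
    (fun A : G.Γ => fun i j => A.1 i j) (fun A : G.Γ => ‖A.1 (Fin.last n) (Fin.last n)‖)
    (fun A => one_le_norm_last_last (G.sub_SU A.2)) ?_
    (ε := ε / (n + 1)) (by positivity) ?_
  · intro A
    refine (pi_norm_le_iff_of_nonneg (norm_nonneg _)).2 fun i =>
      (pi_norm_le_iff_of_nonneg (norm_nonneg _)).2 fun j => ?_
    exact norm_entry_le (G.sub_SU A.2) i j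
  · rintro ⟨A, hA⟩ ⟨B, hB⟩ hAB
    by_contra! hlt
    apply hAB
    have hAS := G.sub_SU hA
    have hd := isUnit_det_of_mem_SU hAS
    have h1 : A⁻¹ * B = 1 := by
      refine hiso _ (G.mul_mem (G.inv_mem hA) hB) fun i j => ?_
      have h2 : (A⁻¹ * B) i j - (1 : Matrix (Fin (n + 1)) (Fin (n + 1)) ℂ) i j =
          ∑ k, A⁻¹ i k * (B k j - A k j) := by
        rw [← Matrix.nonsing_inv_mul _ hd, Matrix.mul_apply, Matrix.mul_apply,
          ← Finset.sum_sub_distrib]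
        simp only [mul_sub]
      rw [h2]
      set d := ‖(fun i j => A i j : Fin (n + 1) → Fin (n + 1) → ℂ) - fun i j => B i j‖ with hdd
      calc ‖∑ k, A⁻¹ i k * (B k j - A k j)‖
          ≤ ∑ k : Fin (n + 1), ‖A (Fin.last n) (Fin.last n)‖ * d := by
            refine norm_sum_le_of_le _ fun k _ => ?_
            rw [norm_mul, ← norm_inv_last_last hAS, norm_sub_rev]
            refine mul_le_mul (norm_entry_le (inv_mem_SU hAS) i k) ?_ (norm_nonneg _)
              (norm_nonneg _)
            exact (norm_le_pi_norm (((fun i j => A i j : Fin (n + 1) → Fin (n + 1) → ℂ) -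
              fun i j => B i j) k) j).trans (norm_le_pi_norm _ k)
        _ = (n + 1) * (‖A (Fin.last n) (Fin.last n)‖ * d) := by simp
        _ < ε := (lt_div_iff₀' (by positivity)).1 hlt
    have h3 : A = B := by
      have := congrArg (A * ·) h1
      simpa [Matrix.mul_nonsing_inv_cancel_left _ _ hd] using this.symm
    exact Subtype.ext h3

lemma DiscreteGroup.finite_norm_le (R : ℝ) :
    {A : G.Γ | ‖(A : Matrix (Fin (n + 1)) (Fin (n + 1)) ℂ) (Fin.last n) (Fin.last n)‖ ≤
      R}.Finite := by
  obtain ⟨N, hN⟩ := G.exists_summable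
  have h1 : 0 < (max R 1)⁻¹ ^ N := by positivity
  have h2 := hN.tendsto_cofinite_zero.eventually (gt_mem_nhds h1)
  refine Set.Finite.subset h2 fun A hA => ?_
  simp only [Set.mem_ofPred_eq, Set.mem_compl_iff, not_lt] at hA ⊢
  have h3 := one_le_norm_last_last (G.sub_SU A.2)
  exact pow_le_pow_left₀ (by positivity)
    (inv_anti₀ (by linarith) (hA.trans (le_max_left _ _))) _

lemma DiscreteGroup.countable : Countable G.Γ := by
  rw [← Set.countable_univ_iff]
  refine (Set.countable_iUnion fun m : ℕ => (G.finite_norm_le m).countable).mono fun A _ => ?_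
  obtain ⟨m, hm⟩ := exists_nat_ge
    ‖(A : Matrix (Fin (n + 1)) (Fin (n + 1)) ℂ) (Fin.last n) (Fin.last n)‖
  exact Set.mem_iUnion.2 ⟨m, hm⟩

end Counting

end BallPaper

namespace BallPaper

section Stabilizer

variable {n : ℕ} (G : DiscreteGroup n) {A : Matrix (Fin (n + 1)) (Fin (n + 1)) ℂ}
  {X Y : Fin (n + 1) → ℂ} {P : ℝ}

lemma inv_mulVec_eigenvector (hA : A ∈ SU n) {u : Fin (n + 1) → ℂ} {a : ℂ} (ha : a ≠ 0)
    (h : A *ᵥ u = a • u) : A⁻¹ *ᵥ u = a⁻¹ • u := by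
  have h1 : A⁻¹ *ᵥ (A *ᵥ u) = u := by
    rw [Matrix.mulVec_mulVec, Matrix.nonsing_inv_mul _ (isUnit_det_of_mem_SU hA),
      Matrix.one_mulVec]
  rw [h, Matrix.mulVec_smul] at h1
  rw [← h1, smul_smul, h1, inv_mul_cancel₀ ha, one_smul]

lemma pow_mulVec_eigenvector {u : Fin (n + 1) → ℂ} {a : ℂ} (h : A *ᵥ u = a • u) (m : ℕ) :
    (A ^ m) *ᵥ u = a ^ m • u := by
  induction m with
  | zero => simp
  | succ m ih =>
    rw [pow_succ, ← Matrix.mulVec_mulVec, h, Matrix.mulVec_smul, ih, smul_smul, pow_succ, mul_comm]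

lemma DiscreteGroup.pow_mem (hA : A ∈ G.Γ) (m : ℕ) : A ^ m ∈ G.Γ := by
  induction m with
  | zero => simpa using G.one_mem
  | succ m ih => simpa [pow_succ] using G.mul_mem ih hA

/-- The translation lengths of the elements of the group preserving the end points
`X`, `Y` of a geodesic. -/
noncomputable def translationLengths (G : DiscreteGroup n) (X Y : Fin (n + 1) → ℂ) :
    AddSubgroup ℝ where
  carrier := {s | ∃ A ∈ G.Γ, ∃ a b : ℂ, a ≠ 0 ∧ b ≠ 0 ∧ A *ᵥ X = a • X ∧ A *ᵥ Y = b • Y ∧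
    s = Real.log ‖a‖}
  zero_mem' := ⟨1, G.one_mem, 1, 1, one_ne_zero, one_ne_zero, by simp, by simp, by simp⟩
  add_mem' := by
    rintro _ _ ⟨A, hA, a, b, ha, hb, hX, hY, rfl⟩ ⟨B, hB, a', b', ha', hb', hX', hY', rfl⟩
    refine ⟨A * B, G.mul_mem hA hB, a' * a, b' * b, mul_ne_zero ha' ha, mul_ne_zero hb' hb,
      ?_, ?_, ?_⟩
    · rw [← Matrix.mulVec_mulVec, hX', Matrix.mulVec_smul, hX, smul_smul]
    · rw [← Matrix.mulVec_mulVec, hY', Matrix.mulVec_smul, hY, smul_smul]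
    · rw [norm_mul, Real.log_mul (norm_ne_zero_iff.2 ha') (norm_ne_zero_iff.2 ha), add_comm]
  neg_mem' := by
    rintro _ ⟨A, hA, a, b, ha, hb, hX, hY, rfl⟩
    refine ⟨A⁻¹, G.inv_mem hA, a⁻¹, b⁻¹, inv_ne_zero ha, inv_ne_zero hb,
      inv_mulVec_eigenvector (G.sub_SU hA) ha hX, inv_mulVec_eigenvector (G.sub_SU hA) hb hY, ?_⟩
    rw [norm_inv, Real.log_inv]

lemma NullPair.eq_one_of_norm_eq_one (h : NullPair X Y P) (hA : A ∈ G.Γ) {a b : ℂ}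
    (hX : A *ᵥ X = a • X) (hY : A *ᵥ Y = b • Y) (ha : ‖a‖ = 1) : A = 1 := by
  have h1 := h.mul_star_eq_one (G.sub_SU hA) hX hY
  have h2 : a * star a = 1 := by
    rw [Complex.star_def, Complex.mul_conj, Complex.normSq_eq_norm_sq, ha]
    simp
  have h3 : b = a := by
    apply star_injective
    apply mul_left_cancel₀ (norm_ne_zero_iff.1 (ha ▸ one_ne_zero) : a ≠ 0)
    rw [h1, h2]
  rw [h3] at hY
  refine G.eq_one_of_eigenvector hA (u := ((1 : ℝ) : ℂ) • X + ((1 : ℝ) : ℂ) • Y) (c := a) ?_ ?_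
  · rw [h.qf_comb]
    linarith [h.neg]
  · simp [Matrix.mulVec_add, hX, hY]

/-- The translation lengths of a discrete group along a geodesic do not accumulate at `0`. -/
lemma NullPair.exists_translationLengths_gap (h : NullPair X Y P) (hXl : X (Fin.last n) = 1)
    (hYl : Y (Fin.last n) = 1) : ∃ ε : ℝ, 0 < ε ∧
      Disjoint (translationLengths G X Y : Set ℝ) (Set.Ioo 0 ε) := by
  have hq : qf (((1 : ℝ) : ℂ) • X + ((1 : ℝ) : ℂ) • Y) < 0 := by
    rw [h.qf_comb]
    linarith [h.neg]
  set Z := ((1 : ℝ) : ℂ) • X + ((1 : ℝ) : ℂ) • Y with hZ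
  have hκ := sub_pos.2 (sqrt_spn_lt hq)
  set κ := ‖Z (Fin.last n)‖ - √(spn Z) with hκd
  set F := {A : G.Γ | ‖(A : Matrix (Fin (n + 1)) (Fin (n + 1)) ℂ) (Fin.last n) (Fin.last n)‖ ≤
    (Real.exp 1 + 1) / κ} with hF
  have hfin : F.Finite := G.finite_norm_le _
  have hsub : (translationLengths G X Y : Set ℝ) ∩ Set.Ioo 0 1 ⊆
      (fun A : G.Γ => Real.log ‖(A.1 *ᵥ X) (Fin.last n)‖) '' F := by
    rintro _ ⟨⟨A, hA, a, b, ha, hb, hX, hY, rfl⟩, h0, h1⟩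
    refine ⟨⟨A, hA⟩, ?_, by simp [hX, hXl]⟩
    have e1 : ‖a‖ < Real.exp 1 := (Real.log_lt_iff_lt_exp (norm_pos_iff.2 ha)).1 h1
    have e2 : 1 < ‖a‖ := by
      rw [← Real.exp_zero]
      exact (Real.lt_log_iff_exp_lt (norm_pos_iff.2 ha)).1 h0
    have e3 := h.mul_star_eq_one (G.sub_SU hA) hX hY
    have e4 : ‖a‖ * ‖b‖ = 1 := by
      have := congrArg norm e3
      simpa using this
    have e5 : ‖b‖ ≤ 1 := by
      by_contra! h5
      nlinarith
    have e6 := le_norm_mulVec_last (G.sub_SU hA) Z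
    have e7 : (A *ᵥ Z) (Fin.last n) = a + b := by
      simp [hZ, Matrix.mulVec_add, hX, hY, hXl, hYl]
    rw [e7] at e6
    have e8 := norm_add_le a b
    exact (le_div_iff₀ hκ).2 (by linarith)
  have hfin' := (hfin.image (fun A : G.Γ => Real.log ‖(A.1 *ᵥ X) (Fin.last n)‖)).subset hsub
  have hcl := hfin'.isClosed
  have h0 : (0 : ℝ) ∈ ((translationLengths G X Y : Set ℝ) ∩ Set.Ioo 0 1)ᶜ := by simp
  obtain ⟨ε, hε, hball⟩ := Metric.isOpen_iff.1 hcl.isOpen_compl _ h0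
  refine ⟨min ε 1, by positivity, Set.disjoint_left.2 fun s hs hs' => ?_⟩
  have h1 : s ∈ Metric.ball (0 : ℝ) ε := by
    rw [Metric.mem_ball, Real.dist_0_eq_abs, abs_of_pos hs'.1]
    exact hs'.2.trans_le (min_le_left _ _)
  exact hball h1 ⟨hs, hs'.1, hs'.2.trans_le (min_le_right _ _)⟩

/-- A primitive hyperbolic element realizes the shortest translation length along its axis. -/
lemma NullPair.log_le_abs_log (h : NullPair X Y P) (hXl : X (Fin.last n) = 1)
    (hYl : Y (Fin.last n) = 1) {γ : Matrix (Fin (n + 1)) (Fin (n + 1)) ℂ} (hγ : γ ∈ G.Γ)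
    {l : ℝ} (hl : 1 < l ^ 2) (hγX : γ *ᵥ X = (l : ℂ) • X) (hγY : γ *ᵥ Y = (l : ℂ)⁻¹ • Y)
    (hprim : ∀ A ∈ G.Γ, ∀ m : ℕ, 2 ≤ m → A ^ m ≠ γ) (hA : A ∈ G.Γ) (hA1 : A ≠ 1) {a b : ℂ}
    (hX : A *ᵥ X = a • X) (hY : A *ᵥ Y = b • Y) : Real.log |l| ≤ |Real.log ‖a‖| := by
  have hne {A : Matrix (Fin (n + 1)) (Fin (n + 1)) ℂ} (hA : A ∈ G.Γ) {a b : ℂ}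
      (hX : A *ᵥ X = a • X) (hY : A *ᵥ Y = b • Y) : a ≠ 0 ∧ b ≠ 0 := by
    have := h.mul_star_eq_one (G.sub_SU hA) hX hY
    constructor <;> rintro rfl <;> simp at this
  have hlabs : 1 < |l| := by
    have : 1 ^ 2 < |l| ^ 2 := by rw [sq_abs]; linarith
    exact lt_of_pow_lt_pow_left₀ 2 (abs_nonneg l) this
  have hlog : 0 < Real.log |l| := Real.log_pos hlabs
  have hlC : (l : ℂ) ≠ 0 := (hne hγ hγX hγY).1
  obtain ⟨ε, hε, hdisj⟩ := h.exists_translationLengths_gap G hXl hYl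
  obtain ⟨g, hg⟩ := AddSubgroup.cyclic_of_isolated_zero hε hdisj
  have hmem : Real.log |l| ∈ translationLengths G X Y :=
    ⟨γ, hγ, l, (l : ℂ)⁻¹, hlC, inv_ne_zero hlC, hγX, hγY, by simp⟩
  have hmemA : Real.log ‖a‖ ∈ translationLengths G X Y :=
    ⟨A, hA, a, b, (hne hA hX hY).1, (hne hA hX hY).2, hX, hY, rfl⟩
  have hgmem : |g| ∈ translationLengths G X Y := by
    have : g ∈ translationLengths G X Y := by
      rw [hg]
      exact AddSubgroup.mem_closure_singleton_self g
    rcases abs_choice g with e | e <;> rw [e]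
    · exact this
    · exact neg_mem this
  rw [hg] at hmem hmemA
  obtain ⟨m, hm⟩ := AddSubgroup.mem_closure_singleton.1 hmem
  obtain ⟨m', hm'⟩ := AddSubgroup.mem_closure_singleton.1 hmemA
  have hm'0 : m' ≠ 0 := by
    rintro rfl
    rw [zero_smul] at hm'
    apply hA1
    refine h.eq_one_of_norm_eq_one G hA hX hY ?_
    exact Real.eq_one_of_pos_of_log_eq_zero (norm_pos_iff.2 (hne hA hX hY).1) hm'.symm
  have hN : (m.natAbs : ℝ) * |g| = Real.log |l| := by
    rw [← abs_of_pos hlog, ← hm, zsmul_eq_mul, abs_mul, Nat.cast_natAbs, Int.cast_abs]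
  obtain ⟨B, hB, c, d, hc, hd, hBX, hBY, hgc⟩ := hgmem
  have hγB : B ^ m.natAbs = γ := by
    have hBN := G.pow_mem hB m.natAbs
    have h1 : γ⁻¹ * B ^ m.natAbs = 1 := by
      refine h.eq_one_of_norm_eq_one G (G.mul_mem (G.inv_mem hγ) hBN)
        (a := c ^ m.natAbs * (l : ℂ)⁻¹) (b := d ^ m.natAbs * ((l : ℂ)⁻¹)⁻¹) ?_ ?_ ?_
      · rw [← Matrix.mulVec_mulVec, pow_mulVec_eigenvector hBX, Matrix.mulVec_smul,
          inv_mulVec_eigenvector (G.sub_SU hγ) hlC hγX, smul_smul]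
      · rw [← Matrix.mulVec_mulVec, pow_mulVec_eigenvector hBY, Matrix.mulVec_smul,
          inv_mulVec_eigenvector (G.sub_SU hγ) (inv_ne_zero hlC) hγY, smul_smul]
      · have h2 : Real.log (‖c‖ ^ m.natAbs) = Real.log |l| := by
          rw [Real.log_pow, ← hgc, hN]
        have h3 : ‖c‖ ^ m.natAbs = |l| :=
          Real.log_injOn_pos (Set.mem_Ioi.2 (by positivity))
            (Set.mem_Ioi.2 (zero_lt_one.trans hlabs)) h2
        rw [norm_mul, norm_pow, norm_inv, h3, Complex.norm_real, Real.norm_eq_abs,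
          mul_inv_cancel₀ (by linarith)]
    have h2 := congrArg (γ * ·) h1
    simpa [Matrix.mul_nonsing_inv_cancel_left _ _ (isUnit_det_of_mem_SU (G.sub_SU hγ))] using h2
  have hm1 : m.natAbs ≤ 1 := by
    by_contra! h2
    exact hprim B hB _ h2 hγB
  have h1 : Real.log |l| ≤ |g| := by
    rw [← hN]
    have : (m.natAbs : ℝ) ≤ 1 := by exact_mod_cast hm1
    nlinarith [abs_nonneg g]
  refine h1.trans ?_
  rw [← hm', zsmul_eq_mul, abs_mul]
  have h2 : (1 : ℝ) ≤ |(m' : ℝ)| := by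
    exact_mod_cast Int.one_le_abs hm'0
  nlinarith [abs_nonneg g]

/-- A nontrivial element of the group maps at most one interior point of a period of the axis
of a primitive hyperbolic element to this period. -/
lemma NullPair.eq_of_two_returns (h : NullPair X Y P) (hXl : X (Fin.last n) = 1)
    (hYl : Y (Fin.last n) = 1) {γ : Matrix (Fin (n + 1)) (Fin (n + 1)) ℂ} (hγ : γ ∈ G.Γ)
    {l : ℝ} (hl : 1 < l ^ 2) (hγX : γ *ᵥ X = (l : ℂ) • X) (hγY : γ *ᵥ Y = (l : ℂ)⁻¹ • Y)
    (hprim : ∀ A ∈ G.Γ, ∀ m : ℕ, 2 ≤ m → A ^ m ≠ γ) (hA : A ∈ G.Γ) (hA1 : A ≠ 1)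
    {τ : ℝ} (hτ : 0 < τ) {t t' s s' : ℝ} (ht : t ∈ Set.Ioo (τ / l ^ 2) τ)
    (ht' : t' ∈ Set.Ioo (τ / l ^ 2) τ) (hs : s ∈ Set.Icc (τ / l ^ 2) τ)
    (hs' : s' ∈ Set.Icc (τ / l ^ 2) τ) {c c' : ℂ}
    (h1 : A *ᵥ (X + (t : ℂ) • Y) = c • (X + (s : ℂ) • Y))
    (h2 : A *ᵥ (X + (t' : ℂ) • Y) = c' • (X + (s' : ℂ) • Y)) : t = t' := by
  by_contra hne
  have hl0 : 0 < l ^ 2 := by linarith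
  have hτl : 0 < τ / l ^ 2 := div_pos hτ hl0
  have t0 : 0 < t := hτl.trans ht.1
  have s0 : 0 < s := hτl.trans_le hs.1
  rcases h.permutes_of_two_points (G.sub_SU hA) t0 (hτl.trans ht'.1) hne s0
    (hτl.trans_le hs'.1) h1 h2 with ⟨a, b, hX, hY⟩ | ⟨a, b, hX, hY⟩
  · have hP : (P : ℂ) ≠ 0 := by exact_mod_cast h.neg.ne
    have h3 := h.mul_star_eq_one (G.sub_SU hA) hX hY
    have ha : a ≠ 0 := by
      rintro rfl
      simp at h3
    have h4 : b * star a = 1 := by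
      have := congrArg star h3
      simpa [mul_comm] using this
    rw [Matrix.mulVec_add, Matrix.mulVec_smul, hX, hY, smul_add, smul_smul, smul_smul] at h1
    have h5 : a = c := by
      have := congrArg (herm · Y) h1
      simp only [herm_add_left, herm_smul_left, h.right, h.pairing, mul_zero, add_zero] at this
      exact mul_right_cancel₀ hP this
    have h6 : t * b = c * s := by
      have := congrArg (herm · X) h1
      simp only [herm_add_left, herm_smul_left, h.left, h.pairing', mul_zero, zero_add] at this
      exact mul_right_cancel₀ hP this
    have h7 : t = s * ‖a‖ ^ 2 := by
      have h8 : a * star a = ((‖a‖ ^ 2 : ℝ) : ℂ) := by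
        rw [Complex.star_def, Complex.mul_conj, Complex.normSq_eq_norm_sq]
      have h9 : (t : ℂ) = ((s * ‖a‖ ^ 2 : ℝ) : ℂ) := by
        rw [Complex.ofReal_mul, ← h8]
        rw [← h5] at h6
        linear_combination star a * h6 - (t : ℂ) * h4
      exact_mod_cast h9
    have h10 := h.log_le_abs_log G hXl hYl hγ hl hγX hγY hprim hA hA1 hX hY
    have h11 : Real.log t = Real.log s + 2 * Real.log ‖a‖ := by
      rw [h7, Real.log_mul s0.ne' (by positivity), Real.log_pow]
      push_cast
      rfl
    have h12 : Real.log (τ / l ^ 2) = Real.log τ - 2 * Real.log |l| := by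
      rw [Real.log_div hτ.ne' hl0.ne', ← sq_abs, Real.log_pow]
      push_cast
      rfl
    have h13 := Real.log_lt_log hτl ht.1
    have h14 := Real.log_lt_log t0 ht.2
    have h15 := Real.log_le_log hτl hs.1
    have h16 := Real.log_le_log s0 hs.2
    have h17 : |Real.log ‖a‖| < Real.log |l| := by
      rw [abs_lt]
      constructor <;> linarith
    linarith
  · exact h.not_swap G hA hX hY

end Stabilizer

end BallPaper

namespace BallPaper

/-- In an integral of a sum of `N`-th powers, the single term reaching modulus one dominates
for large `N`. -/
lemma exists_forall_integral_tsum_pow_ne_zero {ι : Type*} {E : ι → ℝ → ℂ} {i₀ : ι} {T x₀ : ℝ}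
    (hx₀ : x₀ ∈ Set.Ioo 0 T) {w e : ℝ → ℝ} (hE : ∀ i, ContinuousOn (E i) (Set.Icc 0 T))
    {b : ι → ℝ} {N₀ : ℕ} (hb : Summable fun i => b i ^ N₀) (hb0 : ∀ i, 0 ≤ b i)
    (hEb : ∀ i, ∀ x ∈ Set.Icc 0 T, ‖E i x‖ ≤ b i)
    (hE1 : ∀ i, i ≠ i₀ → ∀ x ∈ Set.Icc 0 T, ‖E i x‖ < 1)
    (he : ∀ x ∈ Set.Icc 0 T, E i₀ x = e x) (he0 : ∀ x ∈ Set.Icc 0 T, 0 ≤ e x)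
    (he1 : ∀ x ∈ Set.Icc 0 T, e x ≤ 1) (hex₀ : e x₀ = 1)
    (hec : ContinuousOn e (Set.Icc 0 T)) (hw : ContinuousOn w (Set.Icc 0 T))
    (hw0 : ∀ x ∈ Set.Icc 0 T, 0 < w x) :
    ∃ N₁ : ℕ, ∀ N, N₁ ≤ N → ∫ x in (0 : ℝ)..T, (∑' i, E i x ^ N) * (w x : ℂ) ≠ 0 := by
  classical
  have hT : 0 < T := hx₀.1.trans hx₀.2
  have hx₀' : x₀ ∈ Set.Icc 0 T := Set.Ioo_subset_Icc_self hx₀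
  have hEle : ∀ i, ∀ x ∈ Set.Icc 0 T, ‖E i x‖ ≤ 1 := by
    intro i x hx
    by_cases hi : i = i₀
    · rw [hi, he x hx, Complex.norm_real, Real.norm_eq_abs, abs_of_nonneg (he0 x hx)]
      exact he1 x hx
    · exact (hE1 i hi x hx).le
  obtain ⟨q, hq0, hq1, hq⟩ : ∃ q : ℝ, 0 < q ∧ q < 1 ∧
      ∀ i, i ≠ i₀ → ∀ x ∈ Set.Icc 0 T, ‖E i x‖ ≤ q := by
    have hF : {i | ¬ b i ^ N₀ < (1 / 2) ^ N₀}.Finite :=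
      hb.tendsto_cofinite_zero.eventually (gt_mem_nhds (by positivity))
    have h1 : ∀ i, ∃ r : ℝ, r < 1 ∧ (i ≠ i₀ → ∀ x ∈ Set.Icc 0 T, ‖E i x‖ ≤ r) := by
      intro i
      by_cases hi : i = i₀
      · exact ⟨0, one_pos, fun h => absurd hi h⟩
      · obtain ⟨y, hy, hmax⟩ := isCompact_Icc.exists_isMaxOn ⟨x₀, hx₀'⟩ (hE i).norm
        exact ⟨‖E i y‖, hE1 i hi y hy, fun _ x hx => hmax hx⟩
    choose r hr1 hr using h1
    have h2 : ∀ᶠ q in 𝓝[<] (1 : ℝ), ∀ i ∈ {i | ¬ b i ^ N₀ < (1 / 2) ^ N₀}, r i < q :=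
      (Filter.eventually_all_finite hF).2 fun i _ =>
        mem_nhdsWithin_of_mem_nhds (lt_mem_nhds (hr1 i))
    have h3 : ∀ᶠ q in 𝓝[<] (1 : ℝ), (1 / 2 : ℝ) < q :=
      mem_nhdsWithin_of_mem_nhds (lt_mem_nhds (by norm_num))
    have h4 : ∀ᶠ q in 𝓝[<] (1 : ℝ), q < 1 := self_mem_nhdsWithin
    obtain ⟨q, h2, h3, h4⟩ := (h2.and (h3.and h4)).exists
    refine ⟨q, by linarith, h4, fun i hi x hx => ?_⟩
    by_cases hiF : b i ^ N₀ < (1 / 2) ^ N₀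
    · exact (hEb i x hx).trans ((lt_of_pow_lt_pow_left₀ _ (by norm_num) hiF).le.trans h3.le)
    · exact (hr i hi x hx).trans (h2 i hiF).le
  obtain ⟨W, hW⟩ := isCompact_Icc.exists_bound_of_continuousOn hw
  have hW0 : 0 ≤ W := (norm_nonneg _).trans (hW x₀ hx₀')
  set B := ∑' i, b i ^ N₀ with hB
  have hB0 : 0 ≤ B := tsum_nonneg fun i => pow_nonneg (hb0 i) _
  set r := (q + 1) / 2 with hr
  have hr0 : 0 < r := by linarith
  have hqr : q < r := by linarith
  have hm : 0 < w x₀ / 2 := half_pos (hw0 x₀ hx₀')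
  obtain ⟨η, hη, hball⟩ : ∃ η > 0, ∀ x ∈ Metric.ball x₀ η,
      x ∈ Set.Ioo 0 T ∧ r < e x ∧ w x₀ / 2 < w x := by
    have hn : Set.Icc 0 T ∈ 𝓝 x₀ := Icc_mem_nhds hx₀.1 hx₀.2
    have h1 : ∀ᶠ x in 𝓝 x₀, r < e x :=
      (hec.continuousAt hn).eventually (lt_mem_nhds (by rw [hex₀]; linarith))
    have h2 : ∀ᶠ x in 𝓝 x₀, w x₀ / 2 < w x :=
      (hw.continuousAt hn).eventually (lt_mem_nhds (by linarith))
    have h3 : ∀ᶠ x in 𝓝 x₀, x ∈ Set.Ioo 0 T := Ioo_mem_nhds hx₀.1 hx₀.2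
    exact Metric.eventually_nhds_iff_ball.1 (h3.and (h1.and h2))
  have hlim : Filter.Tendsto (fun N : ℕ => (q / r) ^ N * (B * W * T / q ^ N₀)) atTop (𝓝 0) := by
    have := (tendsto_pow_atTop_nhds_zero_of_lt_one (by positivity)
      ((div_lt_one hr0).2 hqr)).mul_const (B * W * T / q ^ N₀)
    rwa [zero_mul] at this
  have hev := hlim.eventually (gt_mem_nhds (by positivity : 0 < w x₀ / 2 * (2 * η)))
  obtain ⟨N₁, hN₁⟩ := Filter.eventually_atTop.1 hev
  refine ⟨max N₀ N₁, fun N hN hzero => ?_⟩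
  have hNN₀ : N₀ ≤ N := (le_max_left _ _).trans hN
  have hbound : ∀ i, ∀ x ∈ Set.Icc 0 T, ‖E i x ^ N‖ ≤ b i ^ N₀ := by
    intro i x hx
    rw [norm_pow]
    exact (pow_le_pow_of_le_one (norm_nonneg _) (hEle i x hx) hNN₀).trans
      (pow_le_pow_left₀ (norm_nonneg _) (hEb i x hx) _)
  have hcont : ContinuousOn (fun x => ∑' i, E i x ^ N) (Set.Icc 0 T) :=
    continuousOn_tsum (fun i => (hE i).pow N) hb hbound
  have hwC : ContinuousOn (fun x => (w x : ℂ)) (Set.Icc 0 T) :=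
    Complex.continuous_ofReal.comp_continuousOn hw
  have hmain : ContinuousOn (fun x => e x ^ N * w x) (Set.Icc 0 T) := (hec.pow N).mul hw
  have hdiff : ∀ x ∈ Set.Icc 0 T,
      ‖(∑' i, E i x ^ N) * (w x : ℂ) - ((e x ^ N * w x : ℝ) : ℂ)‖ ≤ q ^ (N - N₀) * B * W := by
    intro x hx
    have hs : Summable fun i => E i x ^ N := Summable.of_norm_bounded hb fun i => hbound i x hx
    have h1 : ∑' i, E i x ^ N = E i₀ x ^ N + ∑' i, if i = i₀ then 0 else E i x ^ N :=
      hs.tsum_eq_add_tsum_ite i₀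
    have h2 : (∑' i, E i x ^ N) * (w x : ℂ) - ((e x ^ N * w x : ℝ) : ℂ) =
        (∑' i, if i = i₀ then 0 else E i x ^ N) * (w x : ℂ) := by
      rw [h1, he x hx]
      push_cast
      ring
    rw [h2, norm_mul]
    refine mul_le_mul ?_ (by rw [Complex.norm_real]; exact hW x hx) (norm_nonneg _)
      (by positivity)
    refine tsum_of_norm_bounded (hb.hasSum.mul_left (q ^ (N - N₀))) fun i => ?_
    split_ifs with hi
    · rw [norm_zero]
      have := hb0 i
      positivity
    · rw [norm_pow, ← Nat.sub_add_cancel hNN₀, pow_add, Nat.add_sub_cancel]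
      exact mul_le_mul (pow_le_pow_left₀ (norm_nonneg _) (hq i hi x hx) _)
        (pow_le_pow_left₀ (norm_nonneg _) (hEb i x hx) _) (by positivity) (by positivity)
  have hi1 : IntervalIntegrable (fun x => (∑' i, E i x ^ N) * (w x : ℂ)) volume 0 T :=
    (hcont.mul hwC).intervalIntegrable_of_Icc hT.le
  have hi2 : IntervalIntegrable (fun x => ((e x ^ N * w x : ℝ) : ℂ)) volume 0 T :=
    (Complex.continuous_ofReal.comp_continuousOn hmain).intervalIntegrable_of_Icc hT.le
  have hupper : ∫ x in (0 : ℝ)..T, e x ^ N * w x ≤ q ^ (N - N₀) * B * W * T := by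
    have h1 := intervalIntegral.norm_integral_le_of_norm_le_const (a := 0) (b := T)
      (f := fun x => (∑' i, E i x ^ N) * (w x : ℂ) - ((e x ^ N * w x : ℝ) : ℂ))
      (C := q ^ (N - N₀) * B * W) fun x hx => by
        rw [Set.uIoc_of_le hT.le] at hx
        exact hdiff x (Set.Ioc_subset_Icc_self hx)
    rw [intervalIntegral.integral_sub hi1 hi2, hzero, zero_sub, norm_neg,
      intervalIntegral.integral_ofReal, Complex.norm_real, sub_zero, abs_of_pos hT] at h1
    exact (Real.le_norm_self _).trans h1
  have hlower : r ^ N * (w x₀ / 2) * (2 * η) ≤ ∫ x in (0 : ℝ)..T, e x ^ N * w x := by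
    rw [intervalIntegral.integral_of_le hT.le]
    have hint : IntegrableOn (fun x => e x ^ N * w x) (Set.Icc 0 T) :=
      hmain.integrableOn_compact isCompact_Icc
    have hsub : Metric.ball x₀ η ⊆ Set.Ioc 0 T := fun x hx =>
      Set.Ioo_subset_Ioc_self (hball x hx).1
    have hsub' : Metric.ball x₀ η ⊆ Set.Icc 0 T := hsub.trans Set.Ioc_subset_Icc_self
    calc r ^ N * (w x₀ / 2) * (2 * η)
        = r ^ N * (w x₀ / 2) * volume.real (Metric.ball x₀ η) := by
          rw [Measure.real, Real.volume_ball, ENNReal.toReal_ofReal (by positivity)]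
      _ ≤ ∫ x in Metric.ball x₀ η, e x ^ N * w x := by
          refine setIntegral_ge_of_const_le_real Metric.isOpen_ball.measurableSet
            measure_ball_lt_top.ne (fun x hx => ?_) (hint.mono_set hsub')
          obtain ⟨_, h1, h2⟩ := hball x hx
          have := he0 x (hsub' hx)
          exact mul_le_mul (pow_le_pow_left₀ hr0.le h1.le _) h2.le hm.le (by positivity)
      _ ≤ ∫ x in Set.Ioc 0 T, e x ^ N * w x := by
          refine setIntegral_mono_set (hint.mono_set Set.Ioc_subset_Icc_self) ?_
            hsub.eventuallyLE
          refine (ae_restrict_iff' measurableSet_Ioc).2 (Filter.Eventually.of_forall fun x hx => ?_)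
          have hx' := Set.Ioc_subset_Icc_self hx
          exact mul_nonneg (pow_nonneg (he0 x hx') _) (hw0 x hx').le
  have hfin := hN₁ N ((le_max_right _ _).trans hN)
  have hrN : 0 < r ^ N := by positivity
  have h5 : r ^ N * ((q / r) ^ N * (B * W * T / q ^ N₀)) = q ^ (N - N₀) * B * W * T := by
    have h7 : r ^ N * (q / r) ^ N = q ^ N := by rw [← mul_pow, mul_div_cancel₀ _ hr0.ne']
    rw [pow_sub₀ q hq0.ne' hNN₀, ← mul_assoc, h7]
    ring
  have h6 := mul_lt_mul_of_pos_left hfin hrN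
  rw [h5] at h6
  linarith

end BallPaper

namespace BallPaper

section Geodesic

variable {n : ℕ} {G : DiscreteGroup n} (H : HypElt n G)

/-- The value of the form at the two end points of the geodesic. -/
noncomputable def HypElt.pairing : ℝ := (pair H.X H.Y).re

lemma HypElt.pair_eq : pair H.X H.Y = (H.pairing : ℂ) := by
  refine Complex.ext rfl ?_
  simp [pair, Complex.mul_im, H.X_real, H.Y_real]

lemma HypElt.X_ne_Y : H.X ≠ H.Y := by
  intro h
  have h1 := H.eigX
  rw [h, H.eigY] at h1
  have h2 := congrFun h1 (Fin.last n)
  simp only [Pi.smul_apply, snoc1_last, smul_eq_mul, mul_one] at h2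
  have h3 : H.lam⁻¹ = H.lam := by exact_mod_cast h2
  have h4 := H.lam_sq
  have h5 : H.lam ≠ 0 := by
    intro h0
    norm_num [h0] at h4
  nth_rewrite 1 [sq, ← h3] at h4
  rw [inv_mul_cancel₀ h5] at h4
  exact lt_irrefl _ h4

lemma HypElt.pairing_neg : H.pairing < 0 := by
  have h1 : ∑ i, ‖H.X i - H.Y i‖ ^ 2 = -2 * H.pairing := by
    have h2 : ∀ i, ‖H.X i - H.Y i‖ ^ 2 =
        ‖H.X i‖ ^ 2 + ‖H.Y i‖ ^ 2 - 2 * (H.X i * star (H.Y i)).re := fun i => by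
      simp only [← Complex.normSq_eq_norm_sq]
      exact Complex.normSq_sub _ _
    simp only [h2, Finset.sum_sub_distrib, Finset.sum_add_distrib, H.X_bd, H.Y_bd,
      ← Finset.mul_sum, HypElt.pairing, pair, Complex.sub_re, Complex.re_sum, Complex.one_re]
    ring
  obtain ⟨i, hi⟩ := Function.ne_iff.1 H.X_ne_Y
  have h3 : 0 < ∑ i, ‖H.X i - H.Y i‖ ^ 2 := by
    refine Finset.sum_pos' (fun _ _ => by positivity) ⟨i, Finset.mem_univ _, ?_⟩
    have := norm_pos_iff.2 (sub_ne_zero.2 hi)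
    positivity
  linarith

lemma HypElt.nullPair : NullPair (snoc1 H.X) (snoc1 H.Y) H.pairing where
  left := by rw [herm_self, qf_snoc1, H.X_bd, sub_self, Complex.ofReal_zero]
  right := by rw [herm_self, qf_snoc1, H.Y_bd, sub_self, Complex.ofReal_zero]
  pairing := by rw [herm_snoc1, H.pair_eq]
  neg := H.pairing_neg

/-- The lift of the geodesic with end points `H.X` and `H.Y` to the cone of negative vectors. -/
noncomputable def HypElt.geo (x : ℝ) : Fin (n + 1) → ℂ :=
  ((H.pairing⁻¹ * (1 + x) : ℝ) : ℂ) • snoc1 H.X + ((-(1 - x) / 2 : ℝ) : ℂ) • snoc1 H.Y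

/-- The last coordinate of `H.geo x`. -/
noncomputable def HypElt.geoLast (x : ℝ) : ℝ := H.pairing⁻¹ * (1 + x) - (1 - x) / 2

lemma HypElt.geo_last (x : ℝ) : H.geo x (Fin.last n) = (H.geoLast x : ℂ) := by
  simp only [HypElt.geo, HypElt.geoLast, Pi.add_apply, Pi.smul_apply, snoc1_last, smul_eq_mul]
  push_cast
  ring

lemma HypElt.geoLast_neg {x : ℝ} (hx : x ∈ Set.Ioo (-1 : ℝ) 1) : H.geoLast x < 0 := by
  have h1 := mul_neg_of_neg_of_pos (inv_lt_zero.2 H.pairing_neg) (by linarith [hx.1] : 0 < 1 + x)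
  unfold HypElt.geoLast
  linarith [hx.2]

lemma HypElt.herm_geo (x y : ℝ) : herm (H.geo x) (H.geo y) = ((-(1 - x * y) : ℝ) : ℂ) := by
  have hP : (H.pairing : ℂ) ≠ 0 := by exact_mod_cast H.pairing_neg.ne
  rw [HypElt.geo, HypElt.geo, H.nullPair.herm_comb]
  simp only [Complex.star_def, Complex.conj_ofReal]
  push_cast
  field_simp
  ring

lemma HypElt.qf_geo (x : ℝ) : qf (H.geo x) = -(1 - x ^ 2) := by
  have h := H.herm_geo x x
  rw [herm_self] at h
  rw [sq]
  exact_mod_cast h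

lemma HypElt.qf_geo_neg {x : ℝ} (hx : x ∈ Set.Ioo (-1 : ℝ) 1) : qf (H.geo x) < 0 := by
  rw [H.qf_geo]
  nlinarith [hx.1, hx.2]

lemma snoc1_curve (hn : 0 < n) (x : ℝ) : snoc1 (curve n hn x) =
    (x : ℂ) • Pi.single (lastI n hn).castSucc 1 + Pi.single (Fin.last n) 1 := by
  funext i
  refine Fin.lastCases ?_ (fun i => ?_) i
  · simp [(Fin.castSucc_lt_last (lastI n hn)).ne']
  · simp [curve, Pi.single_apply, (Fin.castSucc_lt_last i).ne]

lemma HypElt.mulVec_curve (hn : 0 < n) (x : ℝ) : H.A *ᵥ snoc1 (curve n hn x) = H.geo x := by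
  have h1 : ¬ n < n - 1 := by omega
  have h2 : n ≠ n - 1 := by omega
  rw [snoc1_curve, Matrix.mulVec_add, Matrix.mulVec_smul, Matrix.mulVec_single_one,
    Matrix.mulVec_single_one]
  funext i
  simp only [HypElt.geo, HypElt.A, Amat, lastI, Pi.add_apply, Pi.smul_apply, Matrix.col_apply,
    Matrix.of_apply, Fin.val_castSucc, Fin.val_last, lt_irrefl, h1, h2, dite_false, if_false,
    if_true, H.pair_eq, Pi.sub_apply, smul_eq_mul]
  push_cast
  ring

lemma HypElt.denom_curve (hn : 0 < n) (x : ℝ) :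
    denom H.A (curve n hn x) = (H.geoLast x : ℂ) := by
  rw [← mulVec_snoc1_last, H.mulVec_curve, H.geo_last]

lemma HypElt.snoc1_act_curve (hn : 0 < n) {x : ℝ} (hx : x ∈ Set.Ioo (-1 : ℝ) 1) :
    snoc1 (act H.A (curve n hn x)) = (H.geoLast x : ℂ)⁻¹ • H.geo x := by
  have h1 : (H.geoLast x : ℂ) ≠ 0 := by exact_mod_cast (H.geoLast_neg hx).ne
  have h2 := mulVec_snoc1 (A := H.A) (z := curve n hn x) (by rwa [H.denom_curve])
  rw [H.mulVec_curve, H.denom_curve] at h2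
  rw [h2, inv_smul_smul₀ h1]

lemma HypElt.one_sub_act_curve (hn : 0 < n) {x : ℝ} (hx : x ∈ Set.Ioo (-1 : ℝ) 1) :
    1 - ∑ i, ‖act H.A (curve n hn x) i‖ ^ 2 = (√(1 - x ^ 2) / -H.geoLast x) ^ 2 := by
  have h1 := qf_snoc1 (act H.A (curve n hn x))
  rw [H.snoc1_act_curve hn hx, qf_smul, H.qf_geo, norm_inv, Complex.norm_real, Real.norm_eq_abs,
    inv_pow, sq_abs] at h1
  rw [div_pow, Real.sq_sqrt (by nlinarith [hx.1, hx.2]), neg_sq]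
  rw [← neg_sub, ← h1]
  ring

lemma HypElt.act_curve_mem_ball (hn : 0 < n) {x : ℝ} (hx : x ∈ Set.Ioo (-1 : ℝ) 1) :
    act H.A (curve n hn x) ∈ ball n := by
  have h1 : 0 < (√(1 - x ^ 2) / -H.geoLast x) ^ 2 := by
    have := neg_pos.2 (H.geoLast_neg hx)
    have : 0 < 1 - x ^ 2 := by nlinarith [hx.1, hx.2]
    positivity
  rw [← H.one_sub_act_curve hn hx, sub_pos] at h1
  exact h1

end Geodesic

section Kernel

variable {n : ℕ} {A : Matrix (Fin (n + 1)) (Fin (n + 1)) ℂ}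

/-- The constant `n!/πⁿ` of the Bergman kernel. -/
noncomputable def bergmanConst (n : ℕ) : ℝ := (Nat.factorial n : ℝ) / Real.pi ^ n

lemma bergmanConst_pos (n : ℕ) : 0 < bergmanConst n := by
  have := Real.pi_pos
  unfold bergmanConst
  positivity

lemma Kc_act_mul_jac (hA : A ∈ SU n) {z : Fin n → ℂ} (hz : z ∈ ball n) (w : Fin n → ℂ) (k : ℕ) :
    Kc (act A z) w ^ k * jac A z ^ k = (bergmanConst n : ℂ) ^ k *
      (-herm (A *ᵥ snoc1 z) (snoc1 w))⁻¹ ^ ((n + 1) * k) := by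
  rw [mulVec_snoc1 (denom_ne_zero hA hz), herm_smul_left, herm_snoc1, ← mul_neg, mul_inv, Kc, jac,
    mul_pow, mul_pow, pow_mul, pow_mul, bergmanConst]
  ring

lemma Kr_rpow_neg_half {z : Fin n → ℂ} {s : ℝ} (hs : 0 < s) (h : 1 - ∑ i, ‖z i‖ ^ 2 = s ^ 2)
    (k : ℕ) : Kr z ^ (-(k : ℝ) / 2) = bergmanConst n ^ (-(k : ℝ) / 2) * s ^ ((n + 1) * k) := by
  have h1 : (((s ^ 2)⁻¹) ^ (n + 1)) ^ (-(k : ℝ) / 2) = s ^ ((n + 1) * k) := by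
    rw [← inv_pow, inv_pow, ← inv_pow, ← pow_mul, inv_pow, ← Real.rpow_natCast,
      ← Real.rpow_neg hs.le, ← Real.rpow_mul hs.le, ← Real.rpow_natCast]
    congr 1
    push_cast
    ring
  rw [Kr, ← bergmanConst, h, Real.mul_rpow (bergmanConst_pos n).le (by positivity), h1]

lemma Kr_rpow_inv {z : Fin n → ℂ} (hz : z ∈ ball n) : Kr z ^ ((n : ℝ) + 1)⁻¹ =
    bergmanConst n ^ ((n : ℝ) + 1)⁻¹ * (1 - ∑ i, ‖z i‖ ^ 2)⁻¹ := by
  have h0 : 0 < (1 - ∑ i, ‖z i‖ ^ 2)⁻¹ := inv_pos.2 (sub_pos.2 hz)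
  rw [Kr, ← bergmanConst, Real.mul_rpow (bergmanConst_pos n).le (by positivity)]
  have := Real.pow_rpow_inv_natCast h0.le (Nat.succ_ne_zero n)
  push_cast at this
  rw [this]

lemma sum_norm_sq_curve (hn : 0 < n) (x : ℝ) : ∑ i, ‖curve n hn x i‖ ^ 2 = x ^ 2 := by
  rw [Finset.sum_eq_single (lastI n hn)]
  · simp [curve]
  · intro i _ hi
    simp [curve, hi]
  · simp

end Kernel

end BallPaper

namespace BallPaper

section Generic

variable {n : ℕ} {G : DiscreteGroup n} (H : HypElt n G)

lemma HypElt.T_mem : H.T ∈ Set.Ioo (0 : ℝ) 1 := by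
  have h := H.lam_sq
  refine ⟨div_pos (by linarith) (by linarith), ?_⟩
  rw [HypElt.T, div_lt_one (by linarith)]
  linarith

/-- The ratio of the coordinates of `H.geo x` with respect to the end points. -/
noncomputable def HypElt.geoRatio (x : ℝ) : ℝ := -H.pairing / 2 * ((1 - x) / (1 + x))

lemma HypElt.geo_eq_smul {x : ℝ} (hx : 0 ≤ x) : H.geo x =
    ((H.pairing⁻¹ * (1 + x) : ℝ) : ℂ) • (snoc1 H.X + (H.geoRatio x : ℂ) • snoc1 H.Y) := by
  have hP := H.pairing_neg.ne
  have h1 : -(1 - x) / 2 = H.pairing⁻¹ * (1 + x) * H.geoRatio x := by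
    have : 1 + x ≠ 0 := by positivity
    unfold HypElt.geoRatio
    field_simp
  rw [HypElt.geo, h1, smul_add, smul_smul]
  push_cast
  rfl

lemma HypElt.geoRatio_mem_Icc {x : ℝ} (hx : x ∈ Set.Icc 0 H.T) :
    H.geoRatio x ∈ Set.Icc (-H.pairing / 2 / H.lam ^ 2) (-H.pairing / 2) := by
  have hP : 0 < -H.pairing / 2 := by linarith [H.pairing_neg]
  have h := H.lam_sq
  have hx1 : 0 < 1 + x := by linarith [hx.1]
  have hx2 := hx.2
  rw [HypElt.T, le_div_iff₀ (by linarith)] at hx2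
  refine ⟨?_, mul_le_of_le_one_right hP.le ((div_le_one hx1).2 (by linarith [hx.1]))⟩
  rw [HypElt.geoRatio, div_eq_mul_inv _ (H.lam ^ 2)]
  refine mul_le_mul_of_nonneg_left ?_ hP.le
  rw [inv_eq_one_div, div_le_div_iff₀ (by linarith) hx1]
  linarith

lemma HypElt.geoRatio_mem_Ioo {x : ℝ} (hx : x ∈ Set.Ioo 0 H.T) :
    H.geoRatio x ∈ Set.Ioo (-H.pairing / 2 / H.lam ^ 2) (-H.pairing / 2) := by
  have hP : 0 < -H.pairing / 2 := by linarith [H.pairing_neg]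
  have h := H.lam_sq
  have hx1 : 0 < 1 + x := by linarith [hx.1]
  have hx2 := hx.2
  rw [HypElt.T, lt_div_iff₀ (by linarith)] at hx2
  refine ⟨?_, mul_lt_of_lt_one_right hP ((div_lt_one hx1).2 (by linarith [hx.1]))⟩
  rw [HypElt.geoRatio, div_eq_mul_inv _ (H.lam ^ 2)]
  refine mul_lt_mul_of_pos_left ?_ hP
  rw [inv_eq_one_div, div_lt_div_iff₀ (by linarith) hx1]
  linarith

lemma HypElt.geoRatio_inj {x x' : ℝ} (hx : 0 ≤ x) (hx' : 0 ≤ x')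
    (h : H.geoRatio x = H.geoRatio x') : x = x' := by
  have hP : -H.pairing / 2 ≠ 0 := by linarith [H.pairing_neg]
  have h1 := mul_left_cancel₀ hP h
  rw [div_eq_div_iff (by positivity) (by positivity)] at h1
  linarith

lemma HypElt.mulVec_ratio {A : Matrix (Fin (n + 1)) (Fin (n + 1)) ℂ} {x y : ℝ} (hx : 0 ≤ x)
    (hy : 0 ≤ y) {c : ℂ} (h : A *ᵥ H.geo x = c • H.geo y) :
    ∃ c' : ℂ, A *ᵥ (snoc1 H.X + (H.geoRatio x : ℂ) • snoc1 H.Y) =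
      c' • (snoc1 H.X + (H.geoRatio y : ℂ) • snoc1 H.Y) := by
  have h1 : ((H.pairing⁻¹ * (1 + x) : ℝ) : ℂ) ≠ 0 := by
    have := H.pairing_neg.ne
    exact_mod_cast mul_ne_zero (inv_ne_zero this) (by positivity)
  rw [H.geo_eq_smul hx, H.geo_eq_smul hy, Matrix.mulVec_smul, smul_smul] at h
  exact ⟨_, by rw [← inv_smul_smul₀ h1 (A *ᵥ _), h, smul_smul]⟩

lemma HypElt.exists_generic : ∃ x₀ ∈ Set.Ioo 0 H.T, ∀ A ∈ G.Γ, A ≠ 1 →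
    ∀ y ∈ Set.Icc 0 H.T, ∀ c : ℂ, A *ᵥ H.geo x₀ ≠ c • H.geo y := by
  have := G.countable
  let S : G.Γ → Set ℝ := fun A => {x | x ∈ Set.Ioo 0 H.T ∧ A.1 ≠ 1 ∧
    ∃ y ∈ Set.Icc 0 H.T, ∃ c : ℂ, A.1 *ᵥ H.geo x = c • H.geo y}
  have hsub : ∀ A, (S A).Subsingleton := by
    rintro A x ⟨hx, hA, y, hy, c, h⟩ x' ⟨hx', -, y', hy', c', h'⟩
    obtain ⟨d, h⟩ := H.mulVec_ratio hx.1.le hy.1 h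
    obtain ⟨d', h'⟩ := H.mulVec_ratio hx'.1.le hy'.1 h'
    exact H.geoRatio_inj hx.1.le hx'.1.le <| H.nullPair.eq_of_two_returns G (snoc1_last _)
      (snoc1_last _) H.mem H.lam_sq H.eigX H.eigY H.primitive A.2 hA
      (τ := -H.pairing / 2) (by linarith [H.pairing_neg]) (H.geoRatio_mem_Ioo hx)
      (H.geoRatio_mem_Ioo hx') (H.geoRatio_mem_Icc hy) (H.geoRatio_mem_Icc hy') h h'
  have hcount : (⋃ A, S A).Countable := Set.countable_iUnion fun A => (hsub A).countable
  obtain ⟨x₀, hx₀, hx₀S⟩ := (hcount.dense_compl ℝ).exists_mem_open isOpen_Ioo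
    (Set.nonempty_Ioo.2 H.T_mem.1)
  refine ⟨x₀, hx₀S, fun A hA hA1 y hy c h => hx₀ ?_⟩
  exact Set.mem_iUnion.2 ⟨⟨A, hA⟩, hx₀S, hA1, y, hy, c, h⟩

end Generic

section Theta

variable {n : ℕ} {G : DiscreteGroup n} (H : HypElt n G)

/-- The normalised kernel between `A` applied to the point of parameter `x₀` of the geodesic and
the point of parameter `x`; its modulus is at most one. -/
noncomputable def HypElt.kernel (x₀ : ℝ) (A : Matrix (Fin (n + 1)) (Fin (n + 1)) ℂ) (x : ℝ) : ℂ :=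
  ((√(1 - x ^ 2) * √(1 - x₀ ^ 2) : ℝ) : ℂ) * (-herm (A *ᵥ H.geo x₀) (H.geo x))⁻¹

lemma HypElt.summand_eq (hn : 0 < n) {A : Matrix (Fin (n + 1)) (Fin (n + 1)) ℂ} (hA : A ∈ G.Γ)
    {x₀ x : ℝ} (hx₀ : x₀ ∈ Set.Ioo (-1 : ℝ) 1) (hx : x ∈ Set.Ioo (-1 : ℝ) 1) (k : ℕ) :
    Kc (act A (act H.A (curve n hn x₀))) (act H.A (curve n hn x)) ^ k *
      jac A (act H.A (curve n hn x₀)) ^ k =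
    (bergmanConst n : ℂ) ^ k * ((-H.geoLast x₀ / √(1 - x₀ ^ 2) : ℝ) : ℂ) ^ ((n + 1) * k) *
      (((√(1 - x ^ 2) / -H.geoLast x : ℝ) : ℂ)⁻¹ ^ ((n + 1) * k)) *
      H.kernel x₀ A x ^ ((n + 1) * k) := by
  have h1 : (H.geoLast x₀ : ℂ) ≠ 0 := by exact_mod_cast (H.geoLast_neg hx₀).ne
  have h2 : (H.geoLast x : ℂ) ≠ 0 := by exact_mod_cast (H.geoLast_neg hx).ne
  have h3 : (√(1 - x ^ 2) : ℂ) ≠ 0 := by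
    exact_mod_cast (Real.sqrt_pos.2 (by nlinarith [hx.1, hx.2])).ne'
  have h4 : (√(1 - x₀ ^ 2) : ℂ) ≠ 0 := by
    exact_mod_cast (Real.sqrt_pos.2 (by nlinarith [hx₀.1, hx₀.2])).ne'
  rw [Kc_act_mul_jac (G.sub_SU hA) (H.act_curve_mem_ball hn hx₀), H.snoc1_act_curve hn hx₀,
    H.snoc1_act_curve hn hx, Matrix.mulVec_smul, herm_smul_left, herm_smul_right, mul_assoc,
    mul_assoc, ← mul_pow, ← mul_pow, HypElt.kernel]
  congr 2
  simp only [Complex.star_def, map_inv₀, Complex.conj_ofReal, inv_neg, mul_inv, inv_inv]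
  push_cast
  field_simp

lemma HypElt.ThetaC_eq (hn : 0 < n) {x₀ : ℝ} (hx₀ : x₀ ∈ Set.Ioo (-1 : ℝ) 1) (k : ℕ) :
    ∃ M : ℂ, M ≠ 0 ∧ ThetaC hn H k (act H.A (curve n hn x₀)) =
      M * ∫ x in (0 : ℝ)..H.T, (∑' A : G.Γ, H.kernel x₀ A x ^ ((n + 1) * k)) *
        (((1 - x ^ 2)⁻¹ : ℝ) : ℂ) := by
  have hκ := bergmanConst_pos n
  set M : ℂ := (cB n k : ℂ) * ((bergmanConst n : ℂ) ^ k *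
    ((-H.geoLast x₀ / √(1 - x₀ ^ 2) : ℝ) : ℂ) ^ ((n + 1) * k)) *
    (((bergmanConst n ^ (-(k : ℝ) / 2) : ℝ) : ℂ) *
      ((bergmanConst n ^ ((n : ℝ) + 1)⁻¹ : ℝ) : ℂ)) with hM
  refine ⟨M, ?_, ?_⟩
  · have h1 : (cB n k : ℂ) ≠ 0 := by
      exact_mod_cast (Nat.choose_pos (Nat.le_add_left n ((n + 1) * (k - 1)))).ne'
    have h2 : (bergmanConst n : ℂ) ≠ 0 := by exact_mod_cast hκ.ne'
    have h3 : ((-H.geoLast x₀ / √(1 - x₀ ^ 2) : ℝ) : ℂ) ≠ 0 := by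
      exact_mod_cast (div_pos (neg_pos.2 (H.geoLast_neg hx₀))
        (Real.sqrt_pos.2 (by nlinarith [hx₀.1, hx₀.2]))).ne'
    have h4 : ∀ a : ℝ, ((bergmanConst n ^ a : ℝ) : ℂ) ≠ 0 := fun a => by
      exact_mod_cast (Real.rpow_pos_of_pos hκ a).ne'
    exact mul_ne_zero (mul_ne_zero h1 (mul_ne_zero (pow_ne_zero _ h2) (pow_ne_zero _ h3)))
      (mul_ne_zero (h4 _) (h4 _))
  · rw [ThetaC, ← intervalIntegral.integral_const_mul]
    refine intervalIntegral.integral_congr fun x hx => ?_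
    rw [Set.uIcc_of_le H.T_mem.1.le] at hx
    have hx' : x ∈ Set.Ioo (-1 : ℝ) 1 := ⟨by linarith [hx.1], hx.2.trans_lt H.T_mem.2⟩
    have hs : 0 < √(1 - x ^ 2) / -H.geoLast x :=
      div_pos (Real.sqrt_pos.2 (by nlinarith [hx'.1, hx'.2])) (neg_pos.2 (H.geoLast_neg hx'))
    have hcb : curve n hn x ∈ ball n := by
      change ∑ i, ‖curve n hn x i‖ ^ 2 < 1
      rw [sum_norm_sq_curve]
      nlinarith [hx'.1, hx'.2]
    have hs' : ((√(1 - x ^ 2) / -H.geoLast x : ℝ) : ℂ) ≠ 0 := by exact_mod_cast hs.ne'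
    simp only [ThetaPt, H.summand_eq hn (Subtype.prop _) hx₀ hx']
    rw [tsum_mul_left, Kr_rpow_neg_half hs (H.one_sub_act_curve hn hx'), Kr_rpow_inv hcb,
      sum_norm_sq_curve, hM]
    generalize √(1 - x ^ 2) / -H.geoLast x = s at hs'
    have h5 : (s : ℂ)⁻¹ ^ ((n + 1) * k) * (s : ℂ) ^ ((n + 1) * k) = 1 := by
      rw [← mul_pow, inv_mul_cancel₀ hs', one_pow]
    push_cast
    linear_combination (cB n k : ℂ) * ((bergmanConst n : ℂ) ^ k *
      (-(H.geoLast x₀ : ℂ) / (√(1 - x₀ ^ 2) : ℝ)) ^ ((n + 1) * k)) *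
      (((bergmanConst n ^ (-(k : ℝ) / 2) : ℝ) : ℂ) *
      ((bergmanConst n ^ ((n : ℝ) + 1)⁻¹ : ℝ) : ℂ)) *
      (∑' A : G.Γ, H.kernel x₀ A x ^ ((n + 1) * k)) * (1 - (x : ℂ) ^ 2)⁻¹ * h5

lemma HypElt.continuous_geo : Continuous H.geo := by
  unfold HypElt.geo
  fun_prop

lemma continuous_spn : Continuous (spn : (Fin (n + 1) → ℂ) → ℝ) := by
  unfold spn
  fun_prop

lemma continuous_herm_right (u : Fin (n + 1) → ℂ) : Continuous (herm u) := by
  unfold herm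
  fun_prop

lemma HypElt.exists_kernel_bound {x₀ : ℝ} (hx₀ : x₀ ∈ Set.Ioo (-1 : ℝ) 1) :
    ∃ δ > 0, ∀ A ∈ G.Γ, ∀ x ∈ Set.Icc 0 H.T,
      δ * ‖A (Fin.last n) (Fin.last n)‖ ≤ ‖herm (A *ᵥ H.geo x₀) (H.geo x)‖ := by
  have hc : Continuous fun x => ‖H.geo x (Fin.last n)‖ - √(spn (H.geo x)) :=
    (((continuous_apply _).comp H.continuous_geo).norm).sub
      (continuous_spn.comp H.continuous_geo).sqrt
  obtain ⟨y, hy, hmin⟩ := (isCompact_Icc (a := 0) (b := H.T)).exists_isMinOn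
    (Set.nonempty_Icc.2 H.T_mem.1.le) hc.continuousOn
  have hy' : y ∈ Set.Ioo (-1 : ℝ) 1 := ⟨by linarith [hy.1], hy.2.trans_lt H.T_mem.2⟩
  have h1 := sub_pos.2 (sqrt_spn_lt (H.qf_geo_neg hy'))
  have h2 := sub_pos.2 (sqrt_spn_lt (H.qf_geo_neg hx₀))
  refine ⟨_, mul_pos h2 h1, fun A hA x hx => ?_⟩
  have hAS := G.sub_SU hA
  have h3 := le_norm_mulVec_last hAS (H.geo x₀)
  have h4 : qf (A *ᵥ H.geo x₀) ≤ 0 := by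
    rw [qf_mulVec hAS]
    exact (H.qf_geo_neg hx₀).le
  refine le_trans ?_ (le_norm_herm h4 (H.geo x))
  have h5 := mul_le_mul h3 (hmin hx) h1.le (norm_nonneg _)
  calc _ = _ := by ring
    _ ≤ _ := h5

lemma HypElt.norm_kernel (x₀ x : ℝ) (A : Matrix (Fin (n + 1)) (Fin (n + 1)) ℂ) :
    ‖H.kernel x₀ A x‖ =
      √(1 - x ^ 2) * √(1 - x₀ ^ 2) / ‖herm (A *ᵥ H.geo x₀) (H.geo x)‖ := by
  rw [HypElt.kernel, norm_mul, norm_inv, norm_neg, Complex.norm_real, Real.norm_eq_abs,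
    abs_of_nonneg (by positivity), div_eq_mul_inv]

lemma HypElt.exists_ThetaC_ne_zero (hn : 0 < n) :
    ∃ k₀ : ℕ, ∀ k : ℕ, k₀ ≤ k → ∃ z ∈ ball n, ThetaC hn H k z ≠ 0 := by
  obtain ⟨x₀, hx₀, hgen⟩ := H.exists_generic
  have hmem : ∀ {x}, x ∈ Set.Icc 0 H.T → x ∈ Set.Ioo (-1 : ℝ) 1 := fun hx =>
    ⟨by linarith [hx.1], hx.2.trans_lt H.T_mem.2⟩
  have hpos : ∀ {x : ℝ}, x ∈ Set.Icc 0 H.T → 0 < 1 - x ^ 2 := fun hx => by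
    nlinarith [(hmem hx).1, (hmem hx).2]
  have hx₀c := Set.Ioo_subset_Icc_self hx₀
  have hx₀' := hmem hx₀c
  obtain ⟨δ, hδ, hbound⟩ := H.exists_kernel_bound hx₀'
  obtain ⟨N₀, hN₀⟩ := G.exists_summable
  have hAl : ∀ A : G.Γ, 0 < ‖A.1 (Fin.last n) (Fin.last n)‖ := fun A =>
    one_pos.trans_le (one_le_norm_last_last (G.sub_SU A.2))
  have hherm : ∀ A : G.Γ, ∀ x ∈ Set.Icc 0 H.T, herm (A.1 *ᵥ H.geo x₀) (H.geo x) ≠ 0 :=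
    fun A x hx => norm_pos_iff.1 ((mul_pos hδ (hAl A)).trans_le (hbound A A.2 x hx))
  have hsq : ∀ {x : ℝ}, √(1 - x ^ 2) ≤ 1 := fun {x} =>
    Real.sqrt_le_one.2 (by nlinarith [sq_nonneg x])
  have hden : ∀ x ∈ Set.Icc 0 H.T, 0 < 1 - x₀ * x := fun x hx => by
    nlinarith [hx.1, (hmem hx).2, hx₀.1, hx₀'.2]
  obtain ⟨N₁, hN₁⟩ := exists_forall_integral_tsum_pow_ne_zero (ι := G.Γ)
    (E := fun A x => H.kernel x₀ A x) (i₀ := ⟨1, G.one_mem⟩) hx₀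
    (w := fun x => (1 - x ^ 2)⁻¹)
    (e := fun x => √(1 - x ^ 2) * √(1 - x₀ ^ 2) / (1 - x₀ * x))
    (fun A => by
      refine ContinuousOn.mul (by fun_prop) (ContinuousOn.inv₀ ?_ fun x hx =>
        neg_ne_zero.2 (hherm A x hx))
      exact ((continuous_herm_right _).comp H.continuous_geo).neg.continuousOn)
    (b := fun A => δ⁻¹ * ‖A.1 (Fin.last n) (Fin.last n)‖⁻¹) (N₀ := N₀)
    (by simpa only [mul_pow] using hN₀.mul_left (δ⁻¹ ^ N₀))
    (fun A => by positivity)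
    (fun A x hx => by
      rw [H.norm_kernel, ← mul_inv, ← one_div]
      exact div_le_div₀ zero_le_one (mul_le_one₀ hsq (Real.sqrt_nonneg _) hsq)
        (mul_pos hδ (hAl A)) (hbound A A.2 x hx))
    (fun A hA x hx => by
      rw [H.norm_kernel, div_lt_one (norm_pos_iff.2 (hherm A x hx))]
      by_contra! hle
      have h1 : ‖herm (A.1 *ᵥ H.geo x₀) (H.geo x)‖ ^ 2 ≤
          qf (A.1 *ᵥ H.geo x₀) * qf (H.geo x) := by
        rw [qf_mulVec (G.sub_SU A.2), H.qf_geo, H.qf_geo, neg_mul_neg]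
        refine (pow_le_pow_left₀ (norm_nonneg _) hle 2).trans_eq ?_
        rw [mul_pow, Real.sq_sqrt (hpos hx).le, Real.sq_sqrt (hpos hx₀c).le, mul_comm]
      obtain ⟨c, hc⟩ := exists_eq_smul_of_norm_herm_le (H.qf_geo_neg (hmem hx)) h1
      exact hgen A A.2 (fun h => hA (Subtype.ext h)) x hx c hc)
    (fun x _ => by
      rw [HypElt.kernel, Matrix.one_mulVec, H.herm_geo, ← Complex.ofReal_neg, neg_neg,
        ← Complex.ofReal_inv, ← Complex.ofReal_mul, div_eq_mul_inv])
    (fun x hx => by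
      have := hden x hx
      positivity)
    (fun x hx => by
      rw [div_le_one (hden x hx), ← Real.sqrt_mul (hpos hx).le, Real.sqrt_le_iff]
      exact ⟨(hden x hx).le, by nlinarith [sq_nonneg (x - x₀)]⟩)
    (by
      rw [Real.mul_self_sqrt (hpos hx₀c).le, ← sq]
      exact div_self (hpos hx₀c).ne')
    (ContinuousOn.div (by fun_prop) (by fun_prop) fun x hx => (hden x hx).ne')
    (ContinuousOn.inv₀ (by fun_prop) fun x hx => (hpos hx).ne')
    (fun x hx => inv_pos.2 (hpos hx))
  refine ⟨N₁, fun k hk => ⟨_, H.act_curve_mem_ball hn hx₀', ?_⟩⟩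
  obtain ⟨M, hM, hTheta⟩ := H.ThetaC_eq hn hx₀' k
  rw [hTheta]
  exact mul_ne_zero hM (hN₁ _ (hk.trans (Nat.le_mul_of_pos_left k n.succ_pos)))

end Theta

end BallPaper

open BallPaper in
/-- Corollary: Θ_C^{(k)} is not identically zero on 𝔹ⁿ for all
sufficiently large k. -/
theorem ThetaC_nonvanishing (n : ℕ) (hn : 0 < n) (G : BallPaper.DiscreteGroup n)
    (H : BallPaper.HypElt n G) :
    ∃ k₀ : ℕ, ∀ k : ℕ, k₀ ≤ k → ∃ z ∈ ball n, ThetaC hn H k z ≠ 0 :=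
  H.exists_ThetaC_ne_zero hn
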